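/- For n ≥ 2 and 1 ≤ i ≤ n−1, the graded piece R_n^{(i)} is isomorphic as a ℂ[S_n]-module to Ind^{S_n}_{S_2} L_{(1,1)}, the induction to S_n of the sign representation of S_2; in particular dim_ℂ R_n^{(i)} = n!/2. -/

import Mathlib

open MvPolynomial

set_option maxHeartbeats 1000000
set_option synthInstance.maxHeartbeats 400000

noncomputable section

/-- the ideal `(x₁y₁, …, xₙyₙ)`. -/
abbrev Bideal (n : ℕ) : Ideal (MvPolynomial (Fin n ⊕ Fin n) ℂ) :=
  Ideal.span (Set.range fun i : Fin n => X (Sum.inl i) * X (Sum.inr i))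

/-- `B n = ℂ[x₁,…,xₙ,y₁,…,yₙ]/(x₁y₁,…,xₙyₙ)`, the `n`-th tensor power of `ℂ[x,y]/(xy)`.
The variable `x_i` is `X (Sum.inl i)` and `y_i` is `X (Sum.inr i)`. -/
abbrev B (n : ℕ) : Type := MvPolynomial (Fin n ⊕ Fin n) ℂ ⧸ Bideal n

abbrev mkB (n : ℕ) : MvPolynomial (Fin n ⊕ Fin n) ℂ →ₐ[ℂ] B n :=
  Ideal.Quotient.mkₐ ℂ (Bideal n)

def xv (n : ℕ) (i : Fin n) : B n := mkB n (X (Sum.inl i))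
def yv (n : ℕ) (i : Fin n) : B n := mkB n (X (Sum.inr i))

/-- the action of a permutation `σ ∈ Sₙ` on `B n`: `σ·xᵢ = x_{σ i}`, `σ·yᵢ = y_{σ i}`. -/
def permB (n : ℕ) (σ : Equiv.Perm (Fin n)) : B n →ₐ[ℂ] B n :=
  Ideal.Quotient.liftₐ (Bideal n)
    ((mkB n).comp (MvPolynomial.rename (Sum.map ⇑σ ⇑σ)))
    (by
      intro a ha
      have h : Bideal n ≤ RingHom.ker ((mkB n).comp (MvPolynomial.rename (Sum.map ⇑σ ⇑σ))).toRingHom := by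
        rw [Ideal.span_le]
        rintro _ ⟨i, rfl⟩
        simp only [SetLike.mem_coe, RingHom.mem_ker, AlgHom.toRingHom_eq_coe, RingHom.coe_coe,
          AlgHom.comp_apply, map_mul, rename_X, Sum.map_inl, Sum.map_inr]
        rw [← map_mul, Ideal.Quotient.mkₐ_eq_mk, Ideal.Quotient.eq_zero_iff_mem]
        exact Ideal.subset_span ⟨σ i, rfl⟩
      exact h ha)

/-- evaluation at the origin. -/
def ev0 (n : ℕ) : B n →ₐ[ℂ] ℂ :=
  Ideal.Quotient.liftₐ (Bideal n) (aeval fun _ => (0 : ℂ))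
    (by
      intro a ha
      have h : Bideal n ≤ RingHom.ker (aeval (R := ℂ) fun _ : Fin n ⊕ Fin n => (0 : ℂ)).toRingHom := by
        rw [Ideal.span_le]
        rintro _ ⟨i, rfl⟩
        simp [RingHom.mem_ker]
      exact h ha)

/-- `Jₙ`, the ideal of `B n` generated by the `Sₙ`-invariant elements vanishing at the origin. -/
def Jn (n : ℕ) : Ideal (B n) :=
  Ideal.span {p : B n | (∀ σ : Equiv.Perm (Fin n), permB n σ p = p) ∧ ev0 n p = 0}

/-- the symmetric coinvariant algebra `Rₙ = Bₙ/Jₙ`. -/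
abbrev Rn (n : ℕ) : Type := B n ⧸ Jn n

/-- the filtration `F^p Bₙ = Σ_{|J|=p} y_J Bₙ`. -/
def FB (n p : ℕ) : Ideal (B n) :=
  Ideal.span {b | ∃ J : Finset (Fin n), J.card = p ∧ b = ∏ t ∈ J, yv n t}

/-- the subquotient `K / K'` of two ideals of `B n`, as a `ℂ`-module. -/
abbrev SQ (n : ℕ) (K K' : Ideal (B n)) : Type :=
  ↥(K.restrictScalars ℂ) ⧸
    (Submodule.comap (K.restrictScalars ℂ).subtype (K'.restrictScalars ℂ))

/-- the class in `K / K'` of an element `p ∈ K`. -/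
def sqMk (n : ℕ) (K K' : Ideal (B n)) (p : B n) (hp : p ∈ K) : SQ n K K' :=
  Submodule.Quotient.mk ⟨p, hp⟩

/-- the transposition `(1 2)` generating the subgroup `S₂ ≤ Sₙ`. -/
def swap01 (n : ℕ) : Equiv.Perm (Fin n) :=
  if h : 1 < n then Equiv.swap ⟨0, by omega⟩ ⟨1, h⟩ else 1

/-- the induced module `Ind^{Sₙ}_{S₂} L_{(1,1)}` of the sign representation of `S₂`,
realized as the space of functions on `Sₙ` transforming by the sign character under
right translation by `S₂`. -/
def SignInd (n : ℕ) : Submodule ℂ (Equiv.Perm (Fin n) → ℂ) where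
  carrier := {f | ∀ g, f (g * swap01 n) = - f g}
  zero_mem' := by intro g; simp
  add_mem' := by
    intro f₁ f₂ h₁ h₂ g
    simp only [Pi.add_apply, h₁ g, h₂ g]
    ring
  smul_mem' := by
    intro c f h g
    simp only [Pi.smul_apply, h g, smul_eq_mul]
    ring

/-- the action of `Sₙ` on `Ind^{Sₙ}_{S₂} L_{(1,1)}`. -/
def signIndAct (n : ℕ) (σ : Equiv.Perm (Fin n)) (f : SignInd n) : SignInd n :=
  ⟨fun τ => (f : Equiv.Perm (Fin n) → ℂ) (σ⁻¹ * τ), by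
    intro g
    have := f.2 (σ⁻¹ * g)
    simpa [mul_assoc] using this⟩

section

variable {n : ℕ}

/-- The set of indices where an exponent vector is negative. -/
def negs (w : Fin n → ℤ) : Finset (Fin n) := Finset.univ.filter fun j => w j < 0

/-- The exponent vector of `∏ t ∈ K, y_t`. -/
def yexp (K : Finset (Fin n)) : Fin n → ℤ := fun j => if j ∈ K then -1 else 0

/-- Two exponent vectors whose monomials have a nonzero product. -/
def Compat (u v : Fin n → ℤ) : Prop := ∀ j, 0 ≤ u j * v j

lemma mem_negs {w : Fin n → ℤ} {j : Fin n} : j ∈ negs w ↔ w j < 0 := by simp [negs]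

lemma negs_add {u v : Fin n → ℤ} (h : Compat u v) : negs (u + v) = negs u ∪ negs v := by
  ext j
  rw [Finset.mem_union, mem_negs, mem_negs, mem_negs, Pi.add_apply]
  rcases mul_nonneg_iff.1 (h j) with h | h <;> omega

lemma negs_yexp (K : Finset (Fin n)) : negs (yexp K) = K := by
  ext j
  rw [mem_negs, yexp]
  split_ifs with h <;> simp [h]

lemma compat_sub_yexp {w : Fin n → ℤ} {K : Finset (Fin n)} (h : K ⊆ negs w) :
    Compat (w - yexp K) (yexp K) := by
  intro j
  simp only [Pi.sub_apply, yexp]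
  split_ifs with hj
  · have := mem_negs.1 (h hj); linarith
  · simp

lemma compat_cons {u v : Fin n → ℤ} {s t : ℤ} :
    Compat (Fin.cons s u : Fin (n + 1) → ℤ) (Fin.cons t v : Fin (n + 1) → ℤ) ↔
      0 ≤ s * t ∧ Compat u v := by
  simp [Compat, Fin.forall_fin_succ]

/-- The multiset of entries of an exponent vector. -/
def vals (w : Fin n → ℤ) : Multiset ℤ := Finset.univ.val.map w

lemma vals_cons (s : ℤ) (w : Fin n → ℤ) :
    vals (Fin.cons s w : Fin (n + 1) → ℤ) = s ::ₘ vals w := by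
  simp [vals]

lemma mem_vals {w : Fin n → ℤ} {s : ℤ} : s ∈ vals w ↔ ∃ j, w j = s := by
  simp [vals, eq_comm]

lemma card_negs_eq (w : Fin n → ℤ) : (negs w).card = (vals w).countP (· < 0) := by
  rw [negs, vals, Multiset.countP_map]
  rfl

lemma card_negs_cons (s : ℤ) (w : Fin n → ℤ) :
    (negs (Fin.cons s w : Fin (n + 1) → ℤ)).card = (negs w).card + if s < 0 then 1 else 0 := by
  rw [card_negs_eq, card_negs_eq, vals_cons, Multiset.countP_cons]

lemma cons_add_cons (s t : ℤ) (u v : Fin n → ℤ) :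
    (Fin.cons s u + Fin.cons t v : Fin (n + 1) → ℤ) = Fin.cons (s + t) (u + v) := by
  funext j
  refine Fin.cases ?_ (fun k => ?_) j <;> simp

/-- The multiset `{-b, …, a - 1}`. -/
def fullVals (b a : ℕ) : Multiset ℤ :=
  (Multiset.range b).map (fun k : ℕ => -(k : ℤ) - 1) + (Multiset.range a).map fun k : ℕ => (k : ℤ)

/-- The multiset `{-b - 1, …, -2, 0, …, a - 1}`. -/
def gapVals (b a : ℕ) : Multiset ℤ :=
  (Multiset.range b).map (fun k : ℕ => -(k : ℤ) - 2) + (Multiset.range a).map fun k : ℕ => (k : ℤ)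

lemma map_range_succ' {α : Type*} (f : ℕ → α) (b : ℕ) :
    (Multiset.range (b + 1)).map f = f 0 ::ₘ (Multiset.range b).map fun k => f (k + 1) := by
  induction b with
  | zero => simp
  | succ b ih => rw [Multiset.range_succ, Multiset.map_cons, ih, Multiset.range_succ,
      Multiset.map_cons, Multiset.cons_swap]

lemma fullVals_succ_left (b a : ℕ) : fullVals (b + 1) a = (-(b : ℤ) - 1) ::ₘ fullVals b a := by
  simp [fullVals, Multiset.range_succ]

lemma fullVals_succ_right (b a : ℕ) : fullVals b (a + 1) = (a : ℤ) ::ₘ fullVals b a := by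
  simp [fullVals, Multiset.range_succ]

lemma gapVals_succ_left (b a : ℕ) : gapVals (b + 1) a = (-(b : ℤ) - 2) ::ₘ gapVals b a := by
  simp [gapVals, Multiset.range_succ]

lemma gapVals_succ_right (b a : ℕ) : gapVals b (a + 1) = (a : ℤ) ::ₘ gapVals b a := by
  simp [gapVals, Multiset.range_succ]

lemma fullVals_eq_cons_gapVals (b a : ℕ) : fullVals (b + 1) a = (-1) ::ₘ gapVals b a := by
  rw [fullVals, map_range_succ', gapVals, Multiset.cons_add]
  congr 3
  funext k
  push_cast
  ring

lemma mem_fullVals {b a : ℕ} {s : ℤ} : s ∈ fullVals b a ↔ -(b : ℤ) ≤ s ∧ s < a := by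
  simp only [fullVals, Multiset.mem_add, Multiset.mem_map, Multiset.mem_range]
  constructor
  · rintro (⟨k, hk, rfl⟩ | ⟨k, hk, rfl⟩) <;> omega
  · intro h
    rcases lt_or_ge s 0 with h0 | h0
    · exact Or.inl ⟨(-s - 1).toNat, by omega, by omega⟩
    · exact Or.inr ⟨s.toNat, by omega, by omega⟩

lemma mem_gapVals {b a : ℕ} {s : ℤ} (h : s ∈ gapVals b a) :
    -(b : ℤ) - 1 ≤ s ∧ s < a ∧ s ≠ -1 := by
  simp only [gapVals, Multiset.mem_add, Multiset.mem_map, Multiset.mem_range] at h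
  rcases h with ⟨k, hk, rfl⟩ | ⟨k, hk, rfl⟩ <;> omega

lemma countP_fullVals (b a : ℕ) : (fullVals b a).countP (· < 0) = b := by
  induction a with
  | zero =>
    induction b with
    | zero => simp [fullVals]
    | succ b ih => rw [fullVals_succ_left, Multiset.countP_cons, ih, if_pos (by omega)]
  | succ a ih => rw [fullVals_succ_right, Multiset.countP_cons, ih, if_neg (by omega)]; rfl

lemma countP_gapVals (b a : ℕ) : (gapVals b a).countP (· < 0) = b := by
  induction a with
  | zero =>
    induction b with
    | zero => simp [gapVals]
    | succ b ih => rw [gapVals_succ_left, Multiset.countP_cons, ih, if_pos (by omega)]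
  | succ a ih => rw [gapVals_succ_right, Multiset.countP_cons, ih, if_neg (by omega)]; rfl

/-- The product of the monomials with exponents `u` and `v` is the monomial of an exponent vector
with multiset of entries `M`. -/
def Good (M : Multiset ℤ) (u v : Fin n → ℤ) : Prop := Compat u v ∧ vals (u + v) = M

lemma good_cons_iff {M : Multiset ℤ} {u v : Fin n → ℤ} {s t : ℤ} :
    Good M (Fin.cons s u : Fin (n + 1) → ℤ) (Fin.cons t v : Fin (n + 1) → ℤ) ↔
      (0 ≤ s * t ∧ Compat u v) ∧ (s + t) ::ₘ vals (u + v) = M := by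
  rw [Good, compat_cons, cons_add_cons, vals_cons]

lemma good_cons_cons {M : Multiset ℤ} {u v : Fin n → ℤ} {s t m : ℤ} (h : s + t = m) :
    Good (m ::ₘ M) (Fin.cons s u : Fin (n + 1) → ℤ) (Fin.cons t v : Fin (n + 1) → ℤ) ↔
      0 ≤ s * t ∧ Good M u v := by
  rw [good_cons_iff, h, Multiset.cons_inj_right, Good, and_assoc]

/-- A pairing of exponent vectors that is triangular for `Good M`. -/
def Triangular (M : Multiset ℤ) (l : List ((Fin n → ℤ) × (Fin n → ℤ))) : Prop :=
  (∀ p ∈ l, Good M p.1 p.2) ∧ l.Pairwise fun p q => ¬ Good M q.1 p.2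

/-- Prepend the heads `(s r, t r)`, for `r < R`, to all pairs in a list. -/
def consFamily (R : ℕ) (s t : ℕ → ℤ) (l : List ((Fin n → ℤ) × (Fin n → ℤ))) :
    List ((Fin (n + 1) → ℤ) × (Fin (n + 1) → ℤ)) :=
  (List.range R).flatMap fun r => l.map fun p => (Fin.cons (s r) p.1, Fin.cons (t r) p.2)

lemma length_consFamily (R : ℕ) (s t : ℕ → ℤ) (l : List ((Fin n → ℤ) × (Fin n → ℤ))) :
    (consFamily R s t l).length = R * l.length := by
  simp [consFamily, List.length_flatMap]

lemma mem_consFamily {R : ℕ} {s t : ℕ → ℤ} {l : List ((Fin n → ℤ) × (Fin n → ℤ))}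
    {q : (Fin (n + 1) → ℤ) × (Fin (n + 1) → ℤ)} :
    q ∈ consFamily R s t l ↔
      ∃ r < R, ∃ p ∈ l, q = (Fin.cons (s r) p.1, Fin.cons (t r) p.2) := by
  simp [consFamily, eq_comm]

lemma triangular_consFamily {R : ℕ} {s t : ℕ → ℤ} {l : List ((Fin n → ℤ) × (Fin n → ℤ))}
    {M : Multiset ℤ} {m : ℤ} (hl : 0 < R → Triangular M l)
    (hm : ∀ r < R, s r + t r = m ∧ 0 ≤ s r * t r)
    (hlt : ∀ r r', r < r' → r' < R → s r' + t r ∉ m ::ₘ M) :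
    Triangular (m ::ₘ M) (consFamily R s t l) := by
  constructor
  · intro q hq
    obtain ⟨r, hr, p, hp, rfl⟩ := mem_consFamily.1 hq
    exact (good_cons_cons (hm r hr).1).2 ⟨(hm r hr).2, (hl (by omega)).1 p hp⟩
  · rw [consFamily, List.pairwise_flatMap]
    constructor
    · intro r hr
      rw [List.mem_range] at hr
      rw [List.pairwise_map]
      refine (hl (by omega)).2.imp fun {p q} h => ?_
      rw [good_cons_cons (hm r hr).1]
      exact fun h' => h h'.2
    · have h2 : (List.range R).Pairwise fun r r' => r < r' ∧ r' < R := by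
        refine List.Pairwise.imp_of_mem ?_ List.pairwise_lt_range
        intro r r' _ hr' h
        exact ⟨h, List.mem_range.1 hr'⟩
      refine h2.imp fun {r r'} h => ?_
      intro p hp q hq hgood
      obtain ⟨p, -, rfl⟩ := List.mem_map.1 hp
      obtain ⟨q, -, rfl⟩ := List.mem_map.1 hq
      refine hlt r r' h.1 h.2 ?_
      rw [← (good_cons_iff.1 hgood).2]
      exact Multiset.mem_cons_self _ _

lemma Triangular.append {M : Multiset ℤ} {l l' : List ((Fin n → ℤ) × (Fin n → ℤ))}
    (h : Triangular M l) (h' : Triangular M l') (hc : ∀ p ∈ l, ∀ q ∈ l', ¬ Good M q.1 p.2) :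
    Triangular M (l ++ l') := by
  constructor
  · intro p hp
    rcases List.mem_append.1 hp with hp | hp
    · exact h.1 p hp
    · exact h'.1 p hp
  · exact List.pairwise_append.2 ⟨h.2, h'.2, hc⟩

lemma Good.negs_subset {M : Multiset ℤ} {u v : Fin n → ℤ} (h : Good M u v) :
    (negs u ∪ negs v).card = M.countP (· < 0) := by
  rw [← negs_add h.1, card_negs_eq, h.2]

lemma exists_gap_list (n a b : ℕ) (hab : a + b = n) :
    ∃ l : List ((Fin n → ℤ) × (Fin n → ℤ)), l.length = n.factorial ∧
      (∀ p ∈ l, (negs p.1).card = b ∧ (negs p.2).card = b) ∧ Triangular (gapVals b a) l := by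
  induction n generalizing a b with
  | zero =>
    obtain ⟨rfl, rfl⟩ : a = 0 ∧ b = 0 := by omega
    refine ⟨[(0, 0)], by simp, by simp [negs], ?_, by simp⟩
    simp [Good, Compat, gapVals, vals]
  | succ n ih =>
    have hneg : ∃ l : List ((Fin (n + 1) → ℤ) × (Fin (n + 1) → ℤ)),
        l.length = b * n.factorial ∧
        (∀ p ∈ l, p.2 0 < 0 ∧ (negs p.1).card = b ∧ (negs p.2).card = b) ∧
        Triangular (gapVals b a) l := by
      rcases b with _ | b
      · exact ⟨[], by simp, by simp, by simp [Triangular]⟩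
      obtain ⟨l, hl1, hl2, hl3⟩ := ih a b (by omega)
      refine ⟨consFamily (b + 1) (fun r => -1 - r) (fun r => -((b : ℤ) + 1 - r)) l,
        by rw [length_consFamily, hl1], ?_, ?_⟩
      · intro q hq
        obtain ⟨r, hr, p, hp, rfl⟩ := mem_consFamily.1 hq
        refine ⟨?_, ?_, ?_⟩
        · simp only [Fin.cons_zero]; omega
        · rw [card_negs_cons, (hl2 p hp).1, if_pos (by omega)]
        · rw [card_negs_cons, (hl2 p hp).2, if_pos (by omega)]
      · rw [gapVals_succ_left]
        refine triangular_consFamily (fun _ => hl3) ?_ ?_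
        · intro r hr
          exact ⟨by ring, mul_nonneg_of_nonpos_of_nonpos (by omega) (by omega)⟩
        · intro r r' h h' hmem
          rw [← gapVals_succ_left] at hmem
          have := mem_gapVals hmem
          push_cast at this
          omega
    have hpos : ∃ l : List ((Fin (n + 1) → ℤ) × (Fin (n + 1) → ℤ)),
        l.length = a * n.factorial ∧
        (∀ p ∈ l, (negs (Fin.tail p.1)).card = b ∧ (negs p.1).card = b ∧ (negs p.2).card = b) ∧
        Triangular (gapVals b a) l := by
      rcases a with _ | a
      · exact ⟨[], by simp, by simp, by simp [Triangular]⟩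
      obtain ⟨l, hl1, hl2, hl3⟩ := ih a b (by omega)
      refine ⟨consFamily (a + 1) (fun r => r) (fun r => (a : ℤ) - r) l,
        by rw [length_consFamily, hl1], ?_, ?_⟩
      · intro q hq
        obtain ⟨r, hr, p, hp, rfl⟩ := mem_consFamily.1 hq
        refine ⟨?_, ?_, ?_⟩
        · rw [Fin.tail_cons, (hl2 p hp).1]
        · rw [card_negs_cons, (hl2 p hp).1, if_neg (by omega), add_zero]
        · rw [card_negs_cons, (hl2 p hp).2, if_neg (by omega), add_zero]
      · rw [gapVals_succ_right]
        refine triangular_consFamily (fun _ => hl3) ?_ ?_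
        · intro r hr
          exact ⟨by ring, mul_nonneg (by omega) (by omega)⟩
        · intro r r' h h' hmem
          rw [← gapVals_succ_right] at hmem
          have := mem_gapVals hmem
          push_cast at this
          omega
    obtain ⟨l, hl1, hl2, hl3⟩ := hneg
    obtain ⟨l', hl1', hl2', hl3'⟩ := hpos
    refine ⟨l ++ l', ?_, ?_, hl3.append hl3' ?_⟩
    · rw [List.length_append, hl1, hl1', Nat.factorial_succ, ← hab]; ring
    · intro p hp
      rcases List.mem_append.1 hp with hp | hp
      · exact (hl2 p hp).2
      · exact (hl2' p hp).2
    · intro p hp q hq hgood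
      have h1 := hgood.negs_subset
      rw [countP_gapVals] at h1
      have h2 := (hl2' q hq).1
      have h3 : (negs (Fin.tail q.1)).map (Fin.succEmb n) ⊆ negs q.1 ∪ negs p.2 := by
        intro j hj
        obtain ⟨k, hk, rfl⟩ := Finset.mem_map.1 hj
        refine Finset.mem_union_left _ ?_
        rw [mem_negs] at hk ⊢
        exact hk
      have h4 : (0 : Fin (n + 1)) ∈ negs q.1 ∪ negs p.2 :=
        Finset.mem_union_right _ (mem_negs.2 (hl2 p hp).1)
      have h5 : (0 : Fin (n + 1)) ∉ (negs (Fin.tail q.1)).map (Fin.succEmb n) := by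
        simp
      have h6 := Finset.card_le_card (Finset.insert_subset h4 h3)
      rw [Finset.card_insert_of_notMem h5, Finset.card_map] at h6
      omega

lemma not_good_of_gap {b a : ℕ} {u v : Fin n → ℤ} {s t : ℤ} (hst : s + t < -1)
    (hu : (negs u).card = b) (hv : (negs v).card = b) :
    ¬ Good (fullVals (b + 1) a) (Fin.cons s u : Fin (n + 1) → ℤ)
      (Fin.cons t v : Fin (n + 1) → ℤ) := by
  intro hgood
  have h1 := hgood.negs_subset
  rw [countP_fullVals] at h1
  obtain ⟨⟨-, hc⟩, hM⟩ := good_cons_iff.1 hgood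
  have h2 : (vals (u + v)).countP (· < 0) = b := by
    have := congrArg (Multiset.countP (· < 0)) hM
    rw [countP_fullVals, Multiset.countP_cons, if_pos (by omega)] at this
    omega
  rw [← card_negs_eq, negs_add hc] at h2
  have hu' : negs u = negs u ∪ negs v :=
    Finset.eq_of_subset_of_card_le Finset.subset_union_left (by omega)
  have hv' : negs v = negs u ∪ negs v :=
    Finset.eq_of_subset_of_card_le Finset.subset_union_right (by omega)
  have h3 : (-1 : ℤ) ∈ (s + t) ::ₘ vals (u + v) := by
    rw [hM, mem_fullVals]; omega
  rcases Multiset.mem_cons.1 h3 with h3 | h3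
  · omega
  · obtain ⟨j, hj⟩ := mem_vals.1 h3
    have hj' : j ∈ negs u ∪ negs v := by
      rw [← negs_add hc, mem_negs]; omega
    have h4 := mem_negs.1 ((Finset.ext_iff.1 hu' j).2 hj')
    have h5 := mem_negs.1 ((Finset.ext_iff.1 hv' j).2 hj')
    rw [Pi.add_apply] at hj
    omega

lemma exists_full_list (n a b : ℕ) (hab : a + b = n) (ha : 1 ≤ a) (hb : 1 ≤ b) :
    ∃ l : List ((Fin n → ℤ) × (Fin n → ℤ)), 2 * l.length = n.factorial ∧
      (∀ p ∈ l, (negs p.2).card = b) ∧ Triangular (fullVals b a) l := by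
  induction n generalizing a b with
  | zero => omega
  | succ n ih =>
    obtain ⟨a, rfl⟩ := Nat.exists_eq_add_of_le' ha
    obtain ⟨b, rfl⟩ := Nat.exists_eq_add_of_le' hb
    have hY : ∃ l : List ((Fin (n + 1) → ℤ) × (Fin (n + 1) → ℤ)),
        2 * l.length = b * n.factorial ∧
        (∀ p ∈ l, p.2 0 < -1 ∧ (negs p.2).card = b + 1 ∧ (negs (Fin.tail p.2)).card = b) ∧
        Triangular (fullVals (b + 1) (a + 1)) l := by
      rcases b with _ | b
      · exact ⟨[], by simp, by simp, by simp [Triangular]⟩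
      obtain ⟨l, hl1, hl2, hl3⟩ := ih (a + 1) (b + 1) (by omega) (by omega) (by omega)
      refine ⟨consFamily (b + 1) (fun r => -r) (fun r => -((b : ℤ) + 2 - r)) l, ?_, ?_, ?_⟩
      · rw [length_consFamily, ← hl1]; ring
      · intro q hq
        obtain ⟨r, hr, p, hp, rfl⟩ := mem_consFamily.1 hq
        refine ⟨?_, ?_, ?_⟩
        · simp only [Fin.cons_zero]; omega
        · rw [card_negs_cons, hl2 p hp, if_pos (by omega)]
        · rw [Fin.tail_cons, hl2 p hp]
      · rw [fullVals_succ_left]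
        refine triangular_consFamily (fun _ => hl3) ?_ ?_
        · intro r hr
          exact ⟨by push_cast; ring, mul_nonneg_of_nonpos_of_nonpos (by omega) (by omega)⟩
        · intro r r' h h' hmem
          rw [← fullVals_succ_left, mem_fullVals] at hmem
          push_cast at hmem
          omega
    have hT : ∃ l : List ((Fin (n + 1) → ℤ) × (Fin (n + 1) → ℤ)),
        l.length = n.factorial ∧
        (∀ p ∈ l, p.1 0 = 0 ∧ p.2 0 = -1 ∧ (negs p.2).card = b + 1 ∧
          (negs (Fin.tail p.1)).card = b) ∧
        Triangular (fullVals (b + 1) (a + 1)) l := by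
      obtain ⟨l, hl1, hl2, hl3⟩ := exists_gap_list n (a + 1) b (by omega)
      refine ⟨consFamily 1 (fun r => 0) (fun r => -1) l, ?_, ?_, ?_⟩
      · rw [length_consFamily, hl1, one_mul]
      · intro q hq
        obtain ⟨r, hr, p, hp, rfl⟩ := mem_consFamily.1 hq
        refine ⟨by simp, by simp, ?_, ?_⟩
        · rw [card_negs_cons, (hl2 p hp).2, if_pos (by omega)]
        · rw [Fin.tail_cons, (hl2 p hp).1]
      · rw [fullVals_eq_cons_gapVals]
        refine triangular_consFamily (fun _ => hl3) ?_ ?_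
        · intro r hr
          exact ⟨by norm_num, by norm_num⟩
        · intro r r' h h'
          omega
    have hX : ∃ l : List ((Fin (n + 1) → ℤ) × (Fin (n + 1) → ℤ)),
        2 * l.length = a * n.factorial ∧
        (∀ p ∈ l, 0 < p.1 0 ∧ (negs p.2).card = b + 1) ∧
        Triangular (fullVals (b + 1) (a + 1)) l := by
      rcases a with _ | a
      · exact ⟨[], by simp, by simp, by simp [Triangular]⟩
      obtain ⟨l, hl1, hl2, hl3⟩ := ih (a + 1) (b + 1) (by omega) (by omega) (by omega)
      refine ⟨consFamily (a + 1) (fun r => (r : ℤ) + 1) (fun r => (a : ℤ) - r) l, ?_, ?_, ?_⟩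
      · rw [length_consFamily, ← hl1]; ring
      · intro q hq
        obtain ⟨r, hr, p, hp, rfl⟩ := mem_consFamily.1 hq
        refine ⟨?_, ?_⟩
        · simp only [Fin.cons_zero]; omega
        · rw [card_negs_cons, hl2 p hp, if_neg (by omega), add_zero]
      · rw [fullVals_succ_right]
        refine triangular_consFamily (fun _ => hl3) ?_ ?_
        · intro r hr
          exact ⟨by push_cast; ring, mul_nonneg (by omega) (by omega)⟩
        · intro r r' h h' hmem
          rw [← fullVals_succ_right, mem_fullVals] at hmem
          push_cast at hmem
          omega
    obtain ⟨lY, hY1, hY2, hY3⟩ := hY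
    obtain ⟨lT, hT1, hT2, hT3⟩ := hT
    obtain ⟨lX, hX1, hX2, hX3⟩ := hX
    refine ⟨(lY ++ lT) ++ lX, ?_, ?_, (hY3.append hT3 ?_).append hX3 ?_⟩
    · rw [List.length_append, List.length_append, mul_add, mul_add, hY1, hT1, hX1,
        Nat.factorial_succ, ← show (a + 1 + b : ℕ) = n by omega]
      ring
    · intro p hp
      rcases List.mem_append.1 hp with hp | hp
      · rcases List.mem_append.1 hp with hp | hp
        · exact (hY2 p hp).2.1
        · exact (hT2 p hp).2.2.1
      · exact (hX2 p hp).2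
    · intro p hp q hq
      obtain ⟨h1, -, h2⟩ := hY2 p hp
      obtain ⟨h3, -, -, h4⟩ := hT2 q hq
      rw [← Fin.cons_self_tail q.1, ← Fin.cons_self_tail p.2]
      exact not_good_of_gap (by omega) h4 h2
    · intro p hp q hq hgood
      have hp0 : p.2 0 < 0 := by
        rcases List.mem_append.1 hp with hp | hp
        · have := (hY2 p hp).1; omega
        · have := (hT2 p hp).2.1; omega
      exact absurd (hgood.1 0) (not_le.2 (mul_neg_of_pos_of_neg (hX2 q hq).1 hp0))

open Equiv in
/-- The summand of the alternant `alt φ w` indexed by `τ`, without its sign. -/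
def altTerm (φ : Fin n → ℤ → ℂ) (w : Fin n → ℤ) (τ : Perm (Fin n)) : ℂ := ∏ k, φ k (w (τ k))

/-- The alternant `det (φ k (w j))`. -/
def alt (φ : Fin n → ℤ → ℂ) (w : Fin n → ℤ) : ℂ :=
  ∑ τ : Equiv.Perm (Fin n), ((Equiv.Perm.sign τ : ℤ) : ℂ) * altTerm φ w τ

/-- The antisymmetrization of a function of exponent vectors. -/
def signedSum (h : (Fin n → ℤ) → ℂ) (w : Fin n → ℤ) : ℂ :=
  ∑ τ : Equiv.Perm (Fin n), ((Equiv.Perm.sign τ : ℤ) : ℂ) * h (w ∘ τ)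

lemma signedSum_comp (h : (Fin n → ℤ) → ℂ) (w : Fin n → ℤ) (σ : Equiv.Perm (Fin n)) :
    signedSum h (w ∘ σ) = ((Equiv.Perm.sign σ : ℤ) : ℂ) * signedSum h w := by
  rw [signedSum, signedSum, Finset.mul_sum]
  refine Eq.trans ?_ (Equiv.sum_comp (Equiv.mulLeft σ) _)
  refine Finset.sum_congr rfl fun τ _ => ?_
  rw [Equiv.coe_mulLeft, map_mul]
  have h1 : ((Equiv.Perm.sign σ : ℤ) : ℂ) * ((Equiv.Perm.sign σ : ℤ) : ℂ) = 1 := by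
    exact_mod_cast Int.units_coe_mul_self _
  simp only [Function.comp_assoc, Equiv.Perm.coe_mul, Units.val_mul, Int.cast_mul]
  linear_combination (-(((Equiv.Perm.sign τ : ℤ) : ℂ) * h (w ∘ σ ∘ τ))) * h1

lemma signedSum_eq_zero_of_not_injective (h : (Fin n → ℤ) → ℂ) {w : Fin n → ℤ}
    (hw : ¬ Function.Injective w) : signedSum h w = 0 := by
  rw [Function.Injective] at hw
  push Not at hw
  obtain ⟨i, j, hij, hne⟩ := hw
  have h1 := signedSum_comp h w (Equiv.swap i j)
  rw [Equiv.Perm.sign_swap hne] at h1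
  have h2 : w ∘ Equiv.swap i j = w := by
    funext k
    rw [Function.comp_apply, Equiv.swap_apply_def]
    split_ifs with h h' <;> simp [*]
  rw [h2] at h1
  push_cast at h1
  linear_combination h1 / 2

lemma alt_comp (φ : Fin n → ℤ → ℂ) (w : Fin n → ℤ) (σ : Equiv.Perm (Fin n)) :
    alt φ (w ∘ σ) = ((Equiv.Perm.sign σ : ℤ) : ℂ) * alt φ w :=
  signedSum_comp (fun q => ∏ k, φ k (q k)) w σ

lemma alt_eq_zero_of_not_injective (φ : Fin n → ℤ → ℂ) {w : Fin n → ℤ}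
    (hw : ¬ Function.Injective w) : alt φ w = 0 :=
  signedSum_eq_zero_of_not_injective (fun q => ∏ k, φ k (q k)) hw

/-- The exponent vector with entries `-b, -b + 1, …, n - b - 1`. -/
def interval (b : ℕ) : Fin n → ℤ := fun k => (k : ℤ) - b

lemma interval_injective (b : ℕ) : Function.Injective (interval b : Fin n → ℤ) := by
  intro i j h
  simp only [interval] at h
  exact Fin.ext (by omega)

lemma exists_perm_of_forall_exists {w e : Fin n → ℤ} (he : Function.Injective e)
    (h : ∀ k, ∃ j, w j = e k) : ∃ τ : Equiv.Perm (Fin n), w ∘ τ = e := by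
  choose f hf using h
  have hinj : Function.Injective f := fun i j hij => he (by rw [← hf i, ← hf j, hij])
  exact ⟨Equiv.ofBijective f (Finite.injective_iff_bijective.1 hinj), funext hf⟩

lemma vals_interval {a b : ℕ} (hab : a + b = n) : vals (interval b : Fin n → ℤ) = fullVals b a := by
  subst hab
  have hnd : (vals (interval b : Fin (a + b) → ℤ)).Nodup :=
    (Multiset.nodup_map_iff_of_injective (interval_injective b)).2 Finset.univ.nodup
  refine Multiset.eq_of_le_of_card_le ((Multiset.le_iff_subset hnd).2 fun s hs => ?_) ?_
  · obtain ⟨j, rfl⟩ := mem_vals.1 hs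
    rw [mem_fullVals, interval]
    omega
  · simp [fullVals, vals, add_comm]

lemma exists_perm_of_vals {a b : ℕ} (hab : a + b = n) {w : Fin n → ℤ} :
    vals w = fullVals b a ↔ ∃ τ : Equiv.Perm (Fin n), w ∘ τ = interval b := by
  rw [← vals_interval hab]
  constructor
  · intro h
    refine exists_perm_of_forall_exists (interval_injective b) fun k => ?_
    rw [← mem_vals, h, mem_vals]
    exact ⟨k, rfl⟩
  · rintro ⟨τ, h⟩
    rw [← h, vals, vals, ← Multiset.map_map]
    rw [Multiset.map_univ_val_equiv]

/-- The rows whose alternant detects the permutations of `interval b`. -/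
def deltaRow (b : ℕ) : Fin n → ℤ → ℂ := fun k t => if t = interval b k then 1 else 0

lemma altTerm_deltaRow (b : ℕ) (w : Fin n → ℤ) (τ : Equiv.Perm (Fin n)) :
    altTerm (deltaRow b) w τ = if w ∘ τ = interval b then 1 else 0 := by
  rw [altTerm]
  split_ifs with h
  · exact Finset.prod_eq_one fun k _ => if_pos (congrFun h k)
  · obtain ⟨k, hk⟩ := Function.ne_iff.1 h
    exact Finset.prod_eq_zero (Finset.mem_univ k) (if_neg hk)

lemma alt_deltaRow_interval (b : ℕ) : alt (deltaRow b) (interval b : Fin n → ℤ) = 1 := by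
  rw [alt, Finset.sum_eq_single 1]
  · simp [altTerm_deltaRow]
  · intro τ _ hτ
    rw [altTerm_deltaRow, if_neg, mul_zero]
    intro h
    exact hτ (Equiv.ext fun k => interval_injective b (congrFun h k))
  · simp

lemma alt_deltaRow_ne_zero_iff {b : ℕ} {w : Fin n → ℤ} :
    alt (deltaRow b) w ≠ 0 ↔ ∃ τ : Equiv.Perm (Fin n), w ∘ τ = interval b := by
  constructor
  · contrapose!
    intro h
    refine Finset.sum_eq_zero fun τ _ => ?_
    rw [altTerm_deltaRow, if_neg (h τ), mul_zero]
  · rintro ⟨τ, hτ⟩ h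
    have := alt_comp (deltaRow b) w τ
    rw [hτ, h, alt_deltaRow_interval, mul_zero] at this
    exact one_ne_zero this

lemma star_alt_deltaRow (b : ℕ) (w : Fin n → ℤ) :
    (starRingEnd ℂ) (alt (deltaRow b) w) = alt (deltaRow b) w := by
  rw [alt, map_sum]
  refine Finset.sum_congr rfl fun τ _ => ?_
  rw [map_mul, altTerm_deltaRow, apply_ite (starRingEnd ℂ)]
  simp

/-- The total degree of the monomial with a given exponent vector. -/
def deg (w : Fin n → ℤ) : ℕ := ∑ j, (w j).natAbs

lemma deg_comp (w : Fin n → ℤ) (σ : Equiv.Perm (Fin n)) : deg (w ∘ σ) = deg w :=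
  Equiv.sum_comp σ fun j => (w j).natAbs

lemma deg_add {u v : Fin n → ℤ} (h : Compat u v) : deg (u + v) = deg u + deg v := by
  rw [deg, deg, deg, ← Finset.sum_add_distrib]
  refine Finset.sum_congr rfl fun j _ => ?_
  rw [Pi.add_apply]
  rcases mul_nonneg_iff.1 (h j) with h | h <;> omega

lemma card_negs_comp (w : Fin n → ℤ) (σ : Equiv.Perm (Fin n)) :
    (negs (w ∘ σ)).card = (negs w).card := by
  rw [card_negs_eq, card_negs_eq, vals, vals, ← Multiset.map_map]
  rw [Multiset.map_univ_val_equiv]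

lemma card_negs_interval {a b : ℕ} (hab : a + b = n) :
    (negs (interval b : Fin n → ℤ)).card = b := by
  rw [card_negs_eq, vals_interval hab, countP_fullVals]

lemma card_negs_of_alt_ne_zero {a b : ℕ} (hab : a + b = n) {w : Fin n → ℤ}
    (h : alt (deltaRow b) w ≠ 0) : (negs w).card = b := by
  obtain ⟨τ, hτ⟩ := alt_deltaRow_ne_zero_iff.1 h
  rw [← card_negs_comp w τ, hτ, card_negs_interval hab]

lemma deg_of_alt_ne_zero {b : ℕ} {w : Fin n → ℤ} (h : alt (deltaRow b) w ≠ 0) :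
    deg w = deg (interval b : Fin n → ℤ) := by
  obtain ⟨τ, hτ⟩ := alt_deltaRow_ne_zero_iff.1 h
  rw [← deg_comp w τ, hτ]

/-- Among the injective exponent vectors with `b` negative entries, those of minimal degree are the
permutations of `interval b`. -/
lemma exists_perm_of_deg_le {a b : ℕ} (hab : a + b = n) {w : Fin n → ℤ}
    (hw : Function.Injective w) (hneg : (negs w).card = b)
    (hdeg : deg w ≤ deg (interval b : Fin n → ℤ)) :
    ∃ τ : Equiv.Perm (Fin n), w ∘ τ = interval b := by
  have key : ∀ v : Fin n → ℤ, Function.Injective v → (negs v).card = b →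
      ∑ t ∈ Finset.univ.image v, (|t| - if t < 0 then (b : ℤ) else a - 1) =
        deg v - (b * b + (n - b) * (a - 1)) := by
    intro v hv hn
    rw [Finset.sum_image fun i _ j _ h => hv h, Finset.sum_sub_distrib, Finset.sum_ite,
      Finset.sum_const, Finset.sum_const]
    have h1 : (Finset.univ.filter fun j => v j < 0).card = b := hn
    have h2 := Finset.card_filter_add_card_filter_not (s := Finset.univ) (fun j => v j < 0)
    rw [h1, Finset.card_univ, Fintype.card_fin] at h2
    have h3 : (n : ℤ) - b = (Finset.univ.filter fun j => ¬ v j < 0).card := by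
      omega
    rw [h1, h3, deg]
    push_cast
    simp only [nsmul_eq_mul]
  have h1 := key w hw hneg
  have h2 := key (interval b) (interval_injective b) (card_negs_interval hab)
  set S := Finset.univ.image w
  set T := Finset.univ.image (interval b : Fin n → ℤ)
  set f : ℤ → ℤ := fun t => |t| - if t < 0 then (b : ℤ) else a - 1 with hf
  have hT : ∀ t, t ∈ T ↔ -(b : ℤ) ≤ t ∧ t < a := by
    intro t
    rw [← mem_fullVals, ← vals_interval hab, mem_vals]
    simp [T]
  have hle : ∑ t ∈ S, f t ≤ ∑ t ∈ T, f t := by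
    rw [h1, h2]
    have : (deg w : ℤ) ≤ deg (interval b : Fin n → ℤ) := by exact_mod_cast hdeg
    linarith
  have hle2 : ∑ t ∈ S \ T, f t ≤ ∑ t ∈ T \ S, f t := by
    have e1 := Finset.sum_inter_add_sum_sdiff S T f
    have e2 := Finset.sum_inter_add_sum_sdiff T S f
    rw [Finset.inter_comm] at e2
    linarith
  have hle3 : ∑ t ∈ T \ S, f t ≤ 0 := by
    refine Finset.sum_nonpos fun t ht => ?_
    have := (hT t).1 (Finset.mem_sdiff.1 ht).1
    simp only [hf]
    split_ifs with h0
    · rw [abs_of_neg h0]; linarith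
    · rw [abs_of_nonneg (not_lt.1 h0)]; omega
  have hpos : ∀ t ∈ S \ T, 0 < f t := by
    intro t ht
    have := (Finset.mem_sdiff.1 ht).2
    rw [hT] at this
    simp only [hf]
    split_ifs with h0
    · rw [abs_of_neg h0]; omega
    · rw [abs_of_nonneg (not_lt.1 h0)]; omega
  have hST : S ⊆ T := by
    rw [← Finset.sdiff_eq_empty_iff_subset]
    by_contra hne
    have := Finset.sum_pos hpos (Finset.nonempty_iff_ne_empty.2 hne)
    linarith
  have hSTeq : S = T := by
    refine Finset.eq_of_subset_of_card_le hST ?_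
    rw [Finset.card_image_of_injective _ hw,
      Finset.card_image_of_injective _ (interval_injective b)]
  refine exists_perm_of_forall_exists (interval_injective b) fun k => ?_
  have : interval b k ∈ S := by
    rw [hSTeq]
    exact Finset.mem_image_of_mem _ (Finset.mem_univ k)
  simpa [S] using this

/-- The rows that contribute to the negative entries in `genRow`. -/
def IsNegRow (b : ℕ) (k : Fin n) : Prop := (k : ℕ) = 0 ∨ 2 ≤ (k : ℕ) ∧ (k : ℕ) ≤ b

instance (b : ℕ) : DecidablePred (IsNegRow b : Fin n → Prop) := fun _ => by
  unfold IsNegRow; infer_instance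

/-- Evaluation points, distinct except that the first two are both zero. -/
def point (k : Fin n) : ℂ := if (k : ℕ) ≤ 1 then 0 else (k : ℕ)

/-- Rows made of powers of the evaluation points. -/
def genRow (b : ℕ) : Fin n → ℤ → ℂ := fun k t =>
  if IsNegRow b k then (if t < 0 then point k ^ (-t - 1).toNat else 0)
  else (if 0 ≤ t then point k ^ t.toNat else 0)

lemma card_isNegRow {b : ℕ} (hb : 1 ≤ b) (hbn : b < n) :
    (Finset.univ.filter (IsNegRow b : Fin n → Prop)).card = b := by
  have : Finset.univ.filter (IsNegRow b : Fin n → Prop) =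
      ((Finset.range (b + 1)).erase 1).attachFin fun m hm => by
        have := Finset.mem_range.1 (Finset.mem_of_mem_erase hm); omega := by
    ext k
    simp only [Finset.mem_filter, Finset.mem_univ, true_and, IsNegRow, Finset.mem_attachFin,
      Finset.mem_erase, Finset.mem_range]
    omega
  rw [this, Finset.card_attachFin, Finset.card_erase_of_mem (by simp; omega), Finset.card_range]
  rfl

lemma alt_genRow_eq_zero {b : ℕ} (hb : 1 ≤ b) (hbn : b < n) {w : Fin n → ℤ}
    (hw : (negs w).card ≠ b) : alt (genRow b) w = 0 := by
  refine Finset.sum_eq_zero fun τ _ => ?_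
  by_contra hne
  have h := Finset.prod_ne_zero_iff.1 (right_ne_zero_of_mul hne)
  apply hw
  rw [← card_negs_comp w τ, ← card_isNegRow hb hbn]
  congr 1
  ext k
  rw [mem_negs, Finset.mem_filter, Function.comp_apply]
  have := h k (Finset.mem_univ k)
  rw [genRow] at this
  split_ifs at this with h1 h2 h3
  · simp [h1, h2]
  · simp at this
  · simp [h1, h3]
  · simp at this

lemma eq_zero_of_sum_pow_eq_zero {s T : Finset (Fin n)} {c x : Fin n → ℂ} (hc : Set.InjOn c s)
    {d : Fin n → ℕ} (hd : Set.InjOn d T) (hlt : ∀ j ∈ T, d j < s.card)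
    (h : ∀ k ∈ s, ∑ j ∈ T, c k ^ d j * x j = 0) : ∀ j ∈ T, x j = 0 := by
  intro i hi
  have hp : (∑ j ∈ T, Polynomial.monomial (d j) (x j)) = 0 := by
    refine Polynomial.eq_zero_of_degree_lt_of_eval_index_eq_zero s hc ?_ ?_
    · refine (Polynomial.degree_sum_le _ _).trans_lt ?_
      rw [Finset.sup_lt_iff (WithBot.bot_lt_coe _)]
      intro j hj
      exact (Polynomial.degree_monomial_le _ _).trans_lt (by exact_mod_cast hlt j hj)
    · intro k hk
      rw [Polynomial.eval_finsetSum, ← h k hk]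
      exact Finset.sum_congr rfl fun j _ => by rw [Polynomial.eval_monomial, mul_comm]
  have := congrArg (Polynomial.coeff · (d i)) hp
  simp only [Polynomial.finsetSum_coeff, Polynomial.coeff_zero] at this
  rw [Finset.sum_eq_single i] at this
  · rwa [Polynomial.coeff_monomial, if_pos rfl] at this
  · intro j hj hji
    rw [Polynomial.coeff_monomial, if_neg fun h => hji (hd hj hi h)]
  · exact fun h => absurd hi h

lemma alt_genRow_interval_ne_zero {b : ℕ} (hb : 1 ≤ b) (hbn : b < n) :
    alt (genRow b) (interval b : Fin n → ℤ) ≠ 0 := by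
  have hdet : alt (genRow b) (interval b : Fin n → ℤ) =
      (Matrix.of fun k j : Fin n => genRow b k (interval b j)).det := by
    rw [← Matrix.det_transpose, Matrix.det_apply', alt]
    rfl
  rw [hdet]
  intro h0
  obtain ⟨x, hx0, hx⟩ := Matrix.exists_mulVec_eq_zero_iff.2 h0
  have hx' : ∀ k, ∑ j, genRow b k (interval b j) * x j = 0 := fun k => congrFun hx k
  have hneg := card_negs_interval (n := n) (a := n - b) (b := b) (by omega)
  have hsplit : ∀ k : Fin n, ∑ j, genRow b k (interval b j) * x j =
      if IsNegRow b k then ∑ j ∈ negs (interval b), point k ^ (-interval b j - 1).toNat * x j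
      else ∑ j ∈ (negs (interval b))ᶜ, point k ^ (interval b j).toNat * x j := by
    intro k
    split_ifs with hk
    · rw [negs, Finset.sum_filter]
      refine Finset.sum_congr rfl fun j _ => ?_
      simp [genRow, hk, ite_mul]
    · rw [negs, Finset.compl_filter, Finset.sum_filter]
      refine Finset.sum_congr rfl fun j _ => ?_
      simp [genRow, hk, ite_mul]
  have hpt : ∀ k l : Fin n, (k : ℕ) ≠ 1 → (l : ℕ) ≠ 1 → point k = point l → k = l := by
    intro k l hk hl h
    simp only [point] at h
    split_ifs at h with h1 h2 h2
    · exact Fin.ext (by omega)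
    · have : (l : ℕ) = 0 := by exact_mod_cast h.symm
      omega
    · have : (k : ℕ) = 0 := by exact_mod_cast h
      omega
    · exact Fin.ext (by exact_mod_cast h)
  have hpt' : ∀ k l : Fin n, (k : ℕ) ≠ 0 → (l : ℕ) ≠ 0 → point k = point l → k = l := by
    intro k l hk hl h
    simp only [point] at h
    split_ifs at h with h1 h2 h2
    · exact Fin.ext (by omega)
    · have : (l : ℕ) = 0 := by exact_mod_cast h.symm
      omega
    · have : (k : ℕ) = 0 := by exact_mod_cast h
      omega
    · exact Fin.ext (by exact_mod_cast h)
  apply hx0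
  funext j
  by_cases hj : j ∈ negs (interval b)
  · refine eq_zero_of_sum_pow_eq_zero (s := Finset.univ.filter (IsNegRow b : Fin n → Prop))
      (T := negs (interval b)) (c := point) (d := fun j => (-interval b j - 1).toNat)
      ?_ ?_ ?_ ?_ j hj
    · intro k hk l hl h
      simp only [Finset.coe_filter, Set.mem_ofPred_eq, Finset.mem_univ, true_and, IsNegRow] at hk hl
      exact hpt k l (by omega) (by omega) h
    · intro k hk l hl h
      have h1 := mem_negs.1 hk
      have h2 := mem_negs.1 hl
      exact interval_injective b (by simp only at h; omega)
    · intro k hk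
      have h1 := mem_negs.1 hk
      rw [card_isNegRow hb hbn]
      simp only [interval] at h1 ⊢
      omega
    · intro k hk
      have h1 := hsplit k
      rwa [hx', if_pos (Finset.mem_filter.1 hk).2, eq_comm] at h1
  · refine eq_zero_of_sum_pow_eq_zero (s := (Finset.univ.filter (IsNegRow b : Fin n → Prop))ᶜ)
      (T := (negs (interval b))ᶜ) (c := point) (d := fun j => (interval b j).toNat)
      ?_ ?_ ?_ ?_ j (Finset.mem_compl.2 hj)
    · intro k hk l hl h
      simp only [Finset.coe_compl, Finset.coe_filter, Set.mem_compl_iff, Set.mem_ofPred_eq,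
        Finset.mem_univ, true_and, IsNegRow] at hk hl
      exact hpt' k l (by omega) (by omega) h
    · intro k hk l hl h
      have h1 := mem_negs.not.1 (Finset.mem_compl.1 hk)
      have h2 := mem_negs.not.1 (Finset.mem_compl.1 hl)
      exact interval_injective b (by simp only at h; omega)
    · intro k hk
      have h1 := mem_negs.not.1 (Finset.mem_compl.1 hk)
      rw [Finset.card_compl, card_isNegRow hb hbn, Fintype.card_fin]
      simp only [interval] at h1 ⊢
      omega
    · intro k hk
      have h1 := hsplit k
      have h2 : ¬ IsNegRow b k := by simpa using hk
      rwa [hx', if_neg h2, eq_comm] at h1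

/-- In low degree, the alternant of `genRow` is a multiple of that of `deltaRow`. -/
lemma alt_genRow_eq {b : ℕ} (hb : 1 ≤ b) (hbn : b < n) {w : Fin n → ℤ}
    (hdeg : deg w ≤ deg (interval b : Fin n → ℤ)) :
    alt (genRow b) w = alt (genRow b) (interval b : Fin n → ℤ) * alt (deltaRow b) w := by
  have hab : n - b + b = n := by omega
  by_cases hw : Function.Injective w
  · by_cases hneg : (negs w).card = b
    · obtain ⟨τ, hτ⟩ := exists_perm_of_deg_le hab hw hneg hdeg
      have h1 := alt_comp (genRow b) w τ
      have h2 := alt_comp (deltaRow b) w τ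
      rw [hτ] at h1 h2
      rw [alt_deltaRow_interval] at h2
      rw [h1]
      linear_combination alt (genRow b) w * h2
    · rw [alt_genRow_eq_zero hb hbn hneg]
      have : alt (deltaRow b) w = 0 := by
        by_contra h
        exact hneg (card_negs_of_alt_ne_zero hab h)
      rw [this, mul_zero]
  · rw [alt_eq_zero_of_not_injective _ hw, alt_eq_zero_of_not_injective _ hw, mul_zero]

/-- The only injective exponent vector dividing `interval b` is `interval b` itself. -/
lemma eq_interval_of_compat_sub {b : ℕ} (hbn : b < n) {q : Fin n → ℤ}
    (hq : Function.Injective q) (hc : Compat q (interval b - q)) : q = interval b := by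
  suffices h : ∀ m : ℕ, ∀ k, (interval b k : ℤ).natAbs = m → q k = interval b k from
    funext fun k => h _ k rfl
  intro m
  induction m using Nat.strong_induction_on with
  | _ m ih =>
    intro k hk
    by_contra hne
    have hk' := hc k
    rw [Pi.sub_apply] at hk'
    have hrange : (0 ≤ q k ∧ q k ≤ interval b k) ∨ (q k ≤ 0 ∧ interval b k ≤ q k) := by
      rcases mul_nonneg_iff.1 hk' with h | h <;> omega
    have hkn := k.2
    have hlt : (q k + b).toNat < n := by simp only [interval] at hrange; omega
    have hl : interval b (⟨(q k + b).toNat, hlt⟩ : Fin n) = q k := by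
      simp only [interval] at hrange ⊢
      omega
    have h1 := ih (q k).natAbs (by omega) ⟨(q k + b).toNat, hlt⟩ (by rw [hl])
    rw [hl] at h1
    have h2 := hq h1
    rw [h2] at hl
    exact hne hl.symm

/-- An algebra with a basis of monomials with signed exponents, multiplied as in `B n`, together
with the permutation action and evaluation at the origin. -/
structure SignedMonomials (n : ℕ) (A : Type*) [CommRing A] [Algebra ℂ A] where
  /-- the monomial basis -/
  mon : Module.Basis (Fin n → ℤ) ℂ A
  mon_zero : mon 0 = 1
  mon_mul : ∀ {u v}, Compat u v → mon u * mon v = mon (u + v)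
  mon_mul_eq_zero : ∀ {u v}, ¬ Compat u v → mon u * mon v = 0
  /-- the permutation action -/
  perm : Equiv.Perm (Fin n) → A →ₐ[ℂ] A
  perm_mon : ∀ σ w, perm σ (mon w) = mon (w ∘ ⇑σ⁻¹)
  /-- evaluation at the origin -/
  ev : A →ₐ[ℂ] ℂ
  ev_mon : ∀ {w}, w ≠ 0 → ev (mon w) = 0

namespace SignedMonomials

variable {A : Type*} [CommRing A] [Algebra ℂ A] (M : SignedMonomials n A)

/-- The ideal generated by the invariants vanishing at the origin. -/
def J : Ideal A := Ideal.span {p | (∀ σ, M.perm σ p = p) ∧ M.ev p = 0}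

/-- The filtration by the number of `y` variables. -/
def F (p : ℕ) : Ideal A := Ideal.span {f | ∃ K : Finset (Fin n), K.card = p ∧ f = M.mon (yexp K)}

@[elab_as_elim]
lemma induction {p : A → Prop} (f : A) (mon : ∀ w, p (M.mon w))
    (add : ∀ f g, p f → p g → p (f + g)) (smul : ∀ (c : ℂ) f, p f → p (c • f)) : p f := by
  have hf : f ∈ Submodule.span ℂ (Set.range M.mon) := by rw [M.mon.span_eq]; trivial
  induction hf using Submodule.span_induction with
  | mem f hf => obtain ⟨w, rfl⟩ := hf; exact mon w
  | zero => simpa using smul 0 _ (mon 0)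
  | add f g _ _ hf hg => exact add f g hf hg
  | smul c f _ hf => exact smul c f hf

lemma mon_sub_yexp_mul {w : Fin n → ℤ} {K : Finset (Fin n)} (h : K ⊆ negs w) :
    M.mon (w - yexp K) * M.mon (yexp K) = M.mon w := by
  rw [M.mon_mul (compat_sub_yexp h), sub_add_cancel]

lemma mon_yexp_mem_F {p : ℕ} {K : Finset (Fin n)} (h : K.card = p) : M.mon (yexp K) ∈ M.F p :=
  Ideal.subset_span ⟨K, h, rfl⟩

lemma mon_mem_F {p : ℕ} {w : Fin n → ℤ} (h : p ≤ (negs w).card) : M.mon w ∈ M.F p := by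
  obtain ⟨K, hK, hc⟩ := Finset.exists_subset_card_eq h
  rw [← M.mon_sub_yexp_mul hK]
  exact Ideal.mul_mem_left _ _ (M.mon_yexp_mem_F hc)

lemma mem_span_of_mem_F {p : ℕ} {f : A} (hf : f ∈ M.F p) :
    f ∈ Submodule.span ℂ (M.mon '' {w | p ≤ (negs w).card}) := by
  induction hf using Submodule.span_induction with
  | mem f hf =>
    obtain ⟨K, hK, rfl⟩ := hf
    exact Submodule.subset_span ⟨_, by simp [negs_yexp, hK], rfl⟩
  | zero => exact zero_mem _
  | add f g _ _ hf hg => exact add_mem hf hg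
  | smul a f h hf =>
    rw [smul_eq_mul]
    clear h
    induction hf using Submodule.span_induction with
    | zero => rw [mul_zero]; exact zero_mem _
    | add f g _ _ hf hg => rw [mul_add]; exact add_mem hf hg
    | smul c f _ hf => rw [mul_smul_comm]; exact Submodule.smul_mem _ _ hf
    | mem f hf =>
      obtain ⟨w, hw, rfl⟩ := hf
      refine M.induction a (fun u => ?_) (fun f g hf hg => ?_) fun c f hf => ?_
      · by_cases hc : Compat u w
        · rw [M.mon_mul hc]
          refine Submodule.subset_span ⟨_, ?_, rfl⟩
          rw [Set.mem_ofPred_eq, negs_add hc]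
          exact le_trans hw (Finset.card_le_card Finset.subset_union_right)
        · rw [M.mon_mul_eq_zero hc]; exact zero_mem _
      · rw [add_mul]; exact add_mem hf hg
      · rw [smul_mul_assoc]; exact Submodule.smul_mem _ _ hf

@[elab_as_elim]
lemma F_induction {p : ℕ} {P : A → Prop} {f : A} (hf : f ∈ M.F p)
    (mon : ∀ w, p ≤ (negs w).card → P (M.mon w))
    (add : ∀ f g, P f → P g → P (f + g)) (smul : ∀ (c : ℂ) f, P f → P (c • f))
    (zero : P 0) : P f := by
  replace hf := M.mem_span_of_mem_F hf
  induction hf using Submodule.span_induction with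
  | mem f hf => obtain ⟨w, hw, rfl⟩ := hf; exact mon w hw
  | zero => exact zero
  | add f g _ _ hf hg => exact add f g hf hg
  | smul c f _ hf => exact smul c f hf

lemma perm_mem_F {p : ℕ} {f : A} (hf : f ∈ M.F p) (σ : Equiv.Perm (Fin n)) :
    M.perm σ f ∈ M.F p := by
  refine M.F_induction hf (fun w hw => ?_) (fun f g hf hg => ?_) (fun c f hf => ?_) ?_
  · rw [M.perm_mon]
    exact M.mon_mem_F (by rwa [card_negs_comp])
  · rw [map_add]; exact add_mem hf hg
  · rw [map_smul]; exact Submodule.smul_of_tower_mem _ c hf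
  · rw [map_zero]; exact zero_mem _

lemma perm_perm (σ τ : Equiv.Perm (Fin n)) (f : A) : M.perm σ (M.perm τ f) = M.perm (σ * τ) f := by
  refine M.induction f (fun w => ?_) (fun f g hf hg => ?_) fun c f hf => ?_
  · rw [M.perm_mon, M.perm_mon, M.perm_mon, mul_inv_rev]; rfl
  · simp only [map_add, hf, hg]
  · simp only [map_smul, hf]

lemma perm_one (f : A) : M.perm 1 f = f := by
  refine M.induction f (fun w => ?_) (fun f g hf hg => ?_) fun c f hf => ?_
  · rw [M.perm_mon]; simp
  · simp only [map_add, hf, hg]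
  · simp only [map_smul, hf]

lemma perm_mem_J {f : A} (hf : f ∈ M.J) (σ : Equiv.Perm (Fin n)) : M.perm σ f ∈ M.J := by
  induction hf using Submodule.span_induction with
  | mem f hf => rw [hf.1 σ]; exact Ideal.subset_span hf
  | zero => rw [map_zero]; exact zero_mem _
  | add f g _ _ hf hg => rw [map_add]; exact add_mem hf hg
  | smul a f _ hf => rw [smul_eq_mul, map_mul]; exact Ideal.mul_mem_left _ _ hf

/-- The summands of the alternant, extended linearly. -/
def termMap (φ : Fin n → ℤ → ℂ) : A →ₗ[ℂ] (Equiv.Perm (Fin n) → ℂ) :=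
  M.mon.constr ℂ (altTerm φ)

/-- The alternant, extended linearly. -/
def altMap (φ : Fin n → ℤ → ℂ) : A →ₗ[ℂ] ℂ := M.mon.constr ℂ (alt φ)

@[simp] lemma termMap_mon (φ : Fin n → ℤ → ℂ) (w : Fin n → ℤ) :
    M.termMap φ (M.mon w) = altTerm φ w := M.mon.constr_basis ℂ _ _

@[simp] lemma altMap_mon (φ : Fin n → ℤ → ℂ) (w : Fin n → ℤ) :
    M.altMap φ (M.mon w) = alt φ w := M.mon.constr_basis ℂ _ _

lemma altMap_eq_sum (φ : Fin n → ℤ → ℂ) (f : A) :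
    M.altMap φ f = ∑ τ, ((Equiv.Perm.sign τ : ℤ) : ℂ) * M.termMap φ f τ := by
  refine M.induction f (fun w => ?_) (fun f g hf hg => ?_) fun c f hf => ?_
  · rw [altMap_mon, termMap_mon, alt]
  · simp only [map_add, hf, hg, Pi.add_apply, mul_add, Finset.sum_add_distrib]
  · rw [map_smul, map_smul, hf, smul_eq_mul, Finset.mul_sum]
    refine Finset.sum_congr rfl fun τ _ => ?_
    rw [Pi.smul_apply, smul_eq_mul]; ring

lemma termMap_perm (φ : Fin n → ℤ → ℂ) (σ τ : Equiv.Perm (Fin n)) (f : A) :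
    M.termMap φ (M.perm σ f) τ = M.termMap φ f (σ⁻¹ * τ) := by
  refine M.induction f (fun w => ?_) (fun f g hf hg => ?_) fun c f hf => ?_
  · rw [perm_mon, termMap_mon, termMap_mon]; rfl
  · simp only [map_add, hf, hg, Pi.add_apply]
  · simp only [map_smul, hf, Pi.smul_apply]

lemma altMap_perm (φ : Fin n → ℤ → ℂ) (σ : Equiv.Perm (Fin n)) (f : A) :
    M.altMap φ (M.perm σ f) = ((Equiv.Perm.sign σ : ℤ) : ℂ) * M.altMap φ f := by
  refine M.induction f (fun w => ?_) (fun f g hf hg => ?_) fun c f hf => ?_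
  · rw [perm_mon, altMap_mon, altMap_mon, alt_comp, Equiv.Perm.sign_inv]
  · simp only [map_add, hf, hg, mul_add]
  · simp only [map_smul, hf, smul_eq_mul]; ring

lemma ev_eq_repr (f : A) : M.ev f = M.mon.repr f 0 := by
  refine M.induction f (fun w => ?_) (fun f g hf hg => ?_) fun c f hf => ?_
  · rw [Module.Basis.repr_self]
    by_cases hw : w = 0
    · subst hw; rw [M.mon_zero, map_one, Finsupp.single_eq_same]
    · rw [M.ev_mon hw, Finsupp.single_eq_of_ne (Ne.symm hw)]
  · simp only [map_add, hf, hg, Finsupp.add_apply]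
  · simp only [map_smul, hf, Finsupp.smul_apply]

lemma repr_perm (σ : Equiv.Perm (Fin n)) (f : A) (q : Fin n → ℤ) :
    M.mon.repr (M.perm σ f) q = M.mon.repr f (q ∘ σ) := by
  refine M.induction f (fun w => ?_) (fun f g hf hg => ?_) fun c f hf => ?_
  · rw [perm_mon, Module.Basis.repr_self, Module.Basis.repr_self, Finsupp.single_apply,
      Finsupp.single_apply]
    refine if_congr ⟨?_, ?_⟩ rfl rfl
    · rintro rfl; funext k; simp
    · rintro rfl; funext k; simp
  · simp only [map_add, hf, hg, Finsupp.add_apply]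
  · simp only [map_smul, hf, Finsupp.smul_apply]

open Classical in
lemma termMap_deltaRow_mon_mul (b : ℕ) (w : Fin n → ℤ) (s : A) (τ : Equiv.Perm (Fin n)) :
    M.termMap (deltaRow b) (M.mon w * s) τ =
      if Compat w (interval b ∘ ⇑τ⁻¹ - w) then M.mon.repr s (interval b ∘ ⇑τ⁻¹ - w) else 0 := by
  refine M.induction s (fun q => ?_) (fun f g hf hg => ?_) fun c f hf => ?_
  · have h : (w + q) ∘ τ = interval b ↔ q = interval b ∘ ⇑τ⁻¹ - w := by
      constructor
      · intro h; rw [← h]; funext k; simp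
      · rintro rfl; funext k; simp
    rw [Module.Basis.repr_self, Finsupp.single_apply]
    by_cases hq : q = interval b ∘ ⇑τ⁻¹ - w
    · rw [← hq, if_pos rfl]
      split_ifs with hc
      · rw [M.mon_mul hc, termMap_mon, altTerm_deltaRow, if_pos (h.2 hq)]
      · rw [M.mon_mul_eq_zero hc, map_zero, Pi.zero_apply]
    · rw [if_neg hq, ite_self]
      by_cases hc : Compat w q
      · rw [M.mon_mul hc, termMap_mon, altTerm_deltaRow, if_neg fun h' => hq (h.1 h')]
      · rw [M.mon_mul_eq_zero hc, map_zero, Pi.zero_apply]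
  · rw [mul_add, map_add, Pi.add_apply, hf, hg, map_add, Finsupp.add_apply]
    split_ifs <;> simp
  · rw [mul_smul_comm, map_smul, Pi.smul_apply, hf, map_smul, Finsupp.smul_apply]
    split_ifs <;> simp

lemma altMap_mon_mul_invariant {b : ℕ} (hbn : b < n) (w : Fin n → ℤ) {s : A}
    (hs : ∀ σ, M.perm σ s = s) (hs0 : M.ev s = 0) :
    M.altMap (deltaRow b) (M.mon w * s) = 0 := by
  classical
  set h : (Fin n → ℤ) → ℂ := fun q =>
    if Compat q (interval b - q) then M.mon.repr s (interval b - q) else 0 with hh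
  have key : M.altMap (deltaRow b) (M.mon w * s) = signedSum h w := by
    rw [altMap_eq_sum, signedSum]
    refine Finset.sum_congr rfl fun τ _ => ?_
    rw [termMap_deltaRow_mon_mul]
    congr 1
    have h1 : (interval b ∘ ⇑τ⁻¹ - w) ∘ τ = interval b - w ∘ τ := by funext k; simp
    refine if_congr ?_ ?_ rfl
    · rw [Compat, Compat, ← Equiv.forall_congr_right τ]
      simp
    · rw [← h1, ← M.repr_perm, hs]
  rw [key]
  by_cases hw : Function.Injective w
  · refine Finset.sum_eq_zero fun τ _ => ?_
    simp only [hh]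
    split_ifs with hc
    · rw [eq_interval_of_compat_sub hbn (hw.comp τ.injective) hc, sub_self, ← M.ev_eq_repr, hs0,
        mul_zero]
    · rw [mul_zero]
  · exact signedSum_eq_zero_of_not_injective h hw

lemma altMap_eq_zero_of_mem_J {b : ℕ} (hbn : b < n) {f : A} (hf : f ∈ M.J) :
    M.altMap (deltaRow b) f = 0 := by
  suffices h : ∀ a, M.altMap (deltaRow b) (a * f) = 0 by simpa using h 1
  induction hf using Submodule.span_induction with
  | mem s hs =>
    intro a
    refine M.induction a (fun w => ?_) (fun f g hf hg => ?_) fun c f hf => ?_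
    · exact M.altMap_mon_mul_invariant hbn w hs.1 hs.2
    · rw [add_mul, map_add, hf, hg, add_zero]
    · rw [smul_mul_assoc, map_smul, hf, smul_zero]
  | zero => simp
  | add f g _ _ hf hg => intro a; rw [mul_add, map_add, hf, hg, add_zero]
  | smul r f _ hf => intro a; rw [smul_eq_mul, ← mul_assoc, hf]

lemma altMap_eq_zero_of_mem_F {b : ℕ} (hbn : b < n) {f : A} (hf : f ∈ M.F (b + 1)) :
    M.altMap (deltaRow b) f = 0 := by
  refine M.F_induction hf (fun w hw => ?_) (fun f g hf hg => ?_) (fun c f hf => ?_) (map_zero _)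
  · rw [altMap_mon]
    by_contra h
    have := card_negs_of_alt_ne_zero (a := n - b) (by omega) h
    omega
  · rw [map_add, hf, hg, add_zero]
  · rw [map_smul, hf, smul_zero]

/-- The ideal by which `F b` is divided to obtain the graded piece. -/
def Q (b : ℕ) : Ideal A := M.J ⊓ M.F b ⊔ M.F (b + 1)

lemma altMap_eq_zero_of_mem_Q {b : ℕ} (hbn : b < n) {f : A} (hf : f ∈ M.Q b) :
    M.altMap (deltaRow b) f = 0 := by
  obtain ⟨g, hg, h, hh, rfl⟩ := Submodule.mem_sup.1 hf
  rw [map_add, M.altMap_eq_zero_of_mem_J hbn hg.1, M.altMap_eq_zero_of_mem_F hbn hh, add_zero]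

lemma perm_mem_Q {b : ℕ} {f : A} (hf : f ∈ M.Q b) (σ : Equiv.Perm (Fin n)) :
    M.perm σ f ∈ M.Q b := by
  obtain ⟨g, hg, h, hh, rfl⟩ := Submodule.mem_sup.1 hf
  rw [map_add]
  exact Submodule.add_mem_sup ⟨M.perm_mem_J hg.1 σ, M.perm_mem_F hg.2 σ⟩ (M.perm_mem_F hh σ)

/-- The pairing of monomials given by the alternant of their product. -/
lemma altMap_mon_mul_mon (φ : Fin n → ℤ → ℂ) (u v : Fin n → ℤ) :
    M.altMap φ (M.mon u * M.mon v) = open Classical in if Compat u v then alt φ (u + v) else 0 := by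
  split_ifs with h
  · rw [M.mon_mul h, altMap_mon]
  · rw [M.mon_mul_eq_zero h, map_zero]

lemma star_altMap_mon_mul_mon (b : ℕ) (u v : Fin n → ℤ) :
    (starRingEnd ℂ) (M.altMap (deltaRow b) (M.mon u * M.mon v)) =
      M.altMap (deltaRow b) (M.mon u * M.mon v) := by
  rw [altMap_mon_mul_mon]
  split_ifs
  · rw [star_alt_deltaRow]
  · simp

lemma deg_of_altMap_ne_zero {b : ℕ} {u v : Fin n → ℤ}
    (h : M.altMap (deltaRow b) (M.mon u * M.mon v) ≠ 0) :
    deg u + deg v = deg (interval b : Fin n → ℤ) := by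
  rw [altMap_mon_mul_mon] at h
  split_ifs at h with hc
  · rw [← deg_add hc, deg_of_alt_ne_zero h]
  · exact absurd rfl h

lemma altMap_ne_zero_iff {a b : ℕ} (hab : a + b = n) {u v : Fin n → ℤ} :
    M.altMap (deltaRow b) (M.mon u * M.mon v) ≠ 0 ↔ Good (fullVals b a) u v := by
  rw [altMap_mon_mul_mon, Good, exists_perm_of_vals hab]
  split_ifs with hc
  · rw [alt_deltaRow_ne_zero_iff, and_iff_right hc]
  · simp [hc]

end SignedMonomials

lemma length_le_finrank {V : Type*} [AddCommGroup V] [Module ℂ V]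
    (l : List (V × Module.Dual ℂ V)) (N : Submodule ℂ V) [FiniteDimensional ℂ N]
    (hl : ∀ p ∈ l, p.1 ∈ N ∧ p.2 p.1 ≠ 0) (hp : l.Pairwise fun p q => p.2 q.1 = 0) :
    l.length ≤ Module.finrank ℂ N := by
  induction l generalizing N with
  | nil => simp
  | cons p l ih =>
    rw [List.pairwise_cons] at hp
    have hfin : FiniteDimensional ℂ ↥(N ⊓ LinearMap.ker p.2) :=
      Submodule.finiteDimensional_of_le inf_le_left
    have h1 := ih (N ⊓ LinearMap.ker p.2)
      (fun q hq => ⟨⟨(hl q (List.mem_cons_of_mem _ hq)).1, hp.1 q hq⟩,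
        (hl q (List.mem_cons_of_mem _ hq)).2⟩) hp.2
    have h2 : N ⊓ LinearMap.ker p.2 < N := by
      refine lt_of_le_of_ne inf_le_left fun h => ?_
      have hpl := hl p List.mem_cons_self
      have := hpl.1
      rw [← h] at this
      exact hpl.2 this.2
    have h3 := Submodule.finrank_lt_finrank_of_lt h2
    rw [List.length_cons]
    omega

/-- A finite set of exponent vectors containing all those that pair nontrivially. -/
def box (n b : ℕ) : Finset (Fin n → ℤ) :=
  (Fintype.piFinset fun _ : Fin n => Finset.Icc (-(n : ℤ)) n).filter fun w => b ≤ (negs w).card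

lemma mem_box {b : ℕ} {w : Fin n → ℤ} :
    w ∈ box n b ↔ (∀ j, -(n : ℤ) ≤ w j ∧ w j ≤ n) ∧ b ≤ (negs w).card := by
  simp [box, Fintype.mem_piFinset]

lemma comp_mem_box {b : ℕ} {w : Fin n → ℤ} (σ : Equiv.Perm (Fin n)) :
    w ∘ σ ∈ box n b ↔ w ∈ box n b := by
  rw [mem_box, mem_box, card_negs_comp]
  exact and_congr_left fun _ => ⟨fun h j => by simpa using h (σ.symm j), fun h j => h (σ j)⟩

lemma mem_box_of_good {a b : ℕ} (hab : a + b = n) {u v : Fin n → ℤ} (h : Good (fullVals b a) u v)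
    (hv : (negs v).card = b) : v ∈ box n b := by
  rw [mem_box]
  refine ⟨fun j => ?_, hv.ge⟩
  have h1 : (u + v) j ∈ fullVals b a := by rw [← h.2, mem_vals]; exact ⟨j, rfl⟩
  rw [mem_fullVals, Pi.add_apply] at h1
  rcases mul_nonneg_iff.1 (h.1 j) with h | h <;> omega

namespace SignedMonomials

variable {A : Type*} [CommRing A] [Algebra ℂ A] (M : SignedMonomials n A)

/-- The map sending `g` to the element representing the functional `w ↦ altMap (g * w)`. -/
def repMap (b : ℕ) : A →ₗ[ℂ] A :=
  ∑ w ∈ box n b, ((M.altMap (deltaRow b)).comp (LinearMap.mulRight ℂ (M.mon w))).smulRight (M.mon w)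

lemma repMap_apply (b : ℕ) (g : A) :
    M.repMap b g = ∑ w ∈ box n b, M.altMap (deltaRow b) (g * M.mon w) • M.mon w := by
  simp [repMap, LinearMap.sum_apply]

lemma repr_repMap (b : ℕ) (g : A) (w : Fin n → ℤ) :
    M.mon.repr (M.repMap b g) w =
      if w ∈ box n b then M.altMap (deltaRow b) (g * M.mon w) else 0 := by
  rw [repMap_apply, map_sum, Finsupp.finsetSum_apply]
  simp only [map_smul, Module.Basis.repr_self, Finsupp.smul_apply, Finsupp.single_apply,
    smul_eq_mul, mul_ite, mul_one, mul_zero]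
  rw [Finset.sum_ite_eq']

lemma repMap_mem_F (b : ℕ) (g : A) : M.repMap b g ∈ M.F b := by
  rw [repMap_apply]
  refine Ideal.sum_mem _ fun w hw => ?_
  exact Submodule.smul_of_tower_mem _ _ (M.mon_mem_F (mem_box.1 hw).2)

lemma perm_repMap (b : ℕ) (σ : Equiv.Perm (Fin n)) (g : A) :
    M.perm σ (M.repMap b g) =
      ((Equiv.Perm.sign σ : ℤ) : ℂ) • M.repMap b (M.perm σ g) := by
  refine M.mon.ext_elem fun w => ?_
  rw [repr_perm, repr_repMap, map_smul, Finsupp.smul_apply, repr_repMap, smul_eq_mul, mul_ite,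
    mul_zero]
  refine if_congr (comp_mem_box σ) ?_ rfl
  have h : g * M.mon (w ∘ σ) = M.perm σ⁻¹ (M.perm σ g * M.mon w) := by
    rw [map_mul, perm_perm, inv_mul_cancel, perm_one, perm_mon, inv_inv]
  rw [h, altMap_perm, Equiv.Perm.sign_inv]

instance finiteDimensional_range_repMap (b : ℕ) :
    FiniteDimensional ℂ (LinearMap.range (M.repMap b)) := by
  have h : LinearMap.range (M.repMap b) ≤
      Submodule.span ℂ (M.mon '' (box n b : Set (Fin n → ℤ))) := by
    rintro _ ⟨g, rfl⟩
    rw [repMap_apply]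
    exact Submodule.sum_mem _ fun w hw =>
      Submodule.smul_mem _ _ (Submodule.subset_span ⟨w, hw, rfl⟩)
  have hfin : FiniteDimensional ℂ (Submodule.span ℂ (M.mon '' (box n b : Set (Fin n → ℤ)))) :=
    FiniteDimensional.span_of_finite ℂ ((box n b).finite_toSet.image _)
  exact Submodule.finiteDimensional_of_le h

lemma length_le_finrank_range_repMap {a b : ℕ} (hab : a + b = n)
    {l : List ((Fin n → ℤ) × (Fin n → ℤ))} (hl : ∀ p ∈ l, (negs p.2).card = b)
    (ht : Triangular (fullVals b a) l) :
    l.length ≤ Module.finrank ℂ (LinearMap.range (M.repMap b)) := by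
  have h := length_le_finrank
    (l.map fun p => (M.repMap b (M.mon p.1), M.mon.coord p.2)) (LinearMap.range (M.repMap b)) ?_ ?_
  · rwa [List.length_map] at h
  · intro q hq
    obtain ⟨p, hp, rfl⟩ := List.mem_map.1 hq
    refine ⟨⟨_, rfl⟩, ?_⟩
    have hg := ht.1 p hp
    simp only [Module.Basis.coord_apply]
    rw [repr_repMap, if_pos (mem_box_of_good hab hg (hl p hp))]
    exact (M.altMap_ne_zero_iff hab).2 hg
  · rw [List.pairwise_map]
    refine ht.2.imp fun {p q} h => ?_
    simp only [Module.Basis.coord_apply]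
    rw [repr_repMap]
    split_ifs with hb
    · by_contra hne
      exact h ((M.altMap_ne_zero_iff hab).1 hne)
    · rfl

/-- A functional that is proportional to the alternant in low degree and vanishes on the ideal
generated by an element of the range of `repMap` detects that the element is zero. -/
lemma repMap_eq_zero {b : ℕ} (μ : A →ₗ[ℂ] ℂ) {c : ℂ} (hc : c ≠ 0)
    (hμ : ∀ w : Fin n → ℤ, deg w ≤ deg (interval b : Fin n → ℤ) →
      μ (M.mon w) = c * M.altMap (deltaRow b) (M.mon w))
    {g : A} (hg : ∀ h, μ (h * M.repMap b g) = 0) : M.repMap b g = 0 := by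
  classical
  by_contra hne
  set S := (box n b).filter fun w => M.altMap (deltaRow b) (g * M.mon w) ≠ 0 with hS
  have hrep : M.repMap b g = ∑ w ∈ S, M.altMap (deltaRow b) (g * M.mon w) • M.mon w := by
    rw [repMap_apply, hS, Finset.sum_filter_of_ne]
    intro w _ h h0
    rw [h0, zero_smul] at h
    exact h rfl
  have hSne : S.Nonempty := by
    by_contra h
    rw [Finset.not_nonempty_iff_eq_empty] at h
    rw [h, Finset.sum_empty] at hrep
    exact hne hrep
  obtain ⟨w₀, hw₀, hmax⟩ := S.exists_max_image deg hSne
  set δ := deg (interval b : Fin n → ℤ) with hδ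
  set m := deg w₀
  set r := M.mon.repr g
  set T := r.support.filter fun u => deg u + m = δ with hT
  set g' : A := ∑ u ∈ T, (starRingEnd ℂ) (r u) • M.mon u with hg'
  have hgsum : ∀ w, M.altMap (deltaRow b) (g * M.mon w) =
      ∑ u ∈ r.support, r u * M.altMap (deltaRow b) (M.mon u * M.mon w) := by
    intro w
    conv_lhs => rw [← M.mon.linearCombination_repr g, Finsupp.linearCombination_apply, Finsupp.sum,
      Finset.sum_mul, map_sum]
    refine Finset.sum_congr rfl fun u _ => ?_
    rw [smul_mul_assoc, map_smul, smul_eq_mul]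
  have hg'sum : ∀ (ν : A →ₗ[ℂ] ℂ) w, ν (g' * M.mon w) =
      ∑ u ∈ T, (starRingEnd ℂ) (r u) * ν (M.mon u * M.mon w) := by
    intro ν w
    rw [hg', Finset.sum_mul, map_sum]
    refine Finset.sum_congr rfl fun u _ => ?_
    rw [smul_mul_assoc, map_smul, smul_eq_mul]
  have h1 : ∀ w ∈ S, μ (g' * M.mon w) = c * M.altMap (deltaRow b) (g' * M.mon w) := by
    intro w hw
    rw [hg'sum, hg'sum, Finset.mul_sum]
    refine Finset.sum_congr rfl fun u hu => ?_
    have hu' := (Finset.mem_filter.1 hu).2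
    have hw' := hmax w hw
    by_cases hcw : Compat u w
    · rw [M.mon_mul hcw, hμ _ (by rw [deg_add hcw]; omega)]
      ring
    · rw [M.mon_mul_eq_zero hcw, map_zero, map_zero]
      ring
  have h2 : ∀ w ∈ S, M.altMap (deltaRow b) (g' * M.mon w) =
      if deg w = m then (starRingEnd ℂ) (M.altMap (deltaRow b) (g * M.mon w)) else 0 := by
    intro w hw
    rw [hg'sum]
    split_ifs with hdeg
    · rw [hgsum, map_sum, hT, Finset.sum_filter_of_ne]
      · refine Finset.sum_congr rfl fun u _ => ?_
        rw [map_mul (starRingEnd ℂ), star_altMap_mon_mul_mon]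
      · intro u _ hu
        rw [← hdeg]
        exact M.deg_of_altMap_ne_zero (right_ne_zero_of_mul hu)
    · refine Finset.sum_eq_zero fun u hu => ?_
      have hu' := (Finset.mem_filter.1 hu).2
      by_contra h
      have := M.deg_of_altMap_ne_zero (right_ne_zero_of_mul h)
      omega
  have h3 : μ (g' * M.repMap b g) = c * ∑ w ∈ S, if deg w = m then
      ((Complex.normSq (M.altMap (deltaRow b) (g * M.mon w)) : ℝ) : ℂ) else 0 := by
    rw [hrep, Finset.mul_sum, map_sum, Finset.mul_sum]
    refine Finset.sum_congr rfl fun w hw => ?_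
    rw [mul_smul_comm, map_smul, h1 w hw, h2 w hw]
    split_ifs
    · rw [smul_eq_mul, Complex.normSq_eq_conj_mul_self]; ring
    · simp
  rw [hg g'] at h3
  have h4 := (mul_eq_zero.1 h3.symm).resolve_left hc
  have h5 : ∑ w ∈ S, (if deg w = m then
      Complex.normSq (M.altMap (deltaRow b) (g * M.mon w)) else 0) = 0 := by
    apply Complex.ofReal_injective
    rw [Complex.ofReal_sum, Complex.ofReal_zero, ← h4]
    refine Finset.sum_congr rfl fun w _ => ?_
    split_ifs <;> simp
  have h6 := (Finset.sum_eq_zero_iff_of_nonneg fun w _ => by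
    split_ifs
    · exact Complex.normSq_nonneg _
    · exact le_rfl).1 h5 w₀ hw₀
  rw [if_pos rfl, Complex.normSq_eq_zero] at h6
  exact (Finset.mem_filter.1 hw₀).2 h6

lemma eq_zero_of_mem_range_repMap_of_mem_Q {b : ℕ} (hbn : b < n) {f : A}
    (hf : f ∈ LinearMap.range (M.repMap b)) (hQ : f ∈ M.Q b) : f = 0 := by
  obtain ⟨g, rfl⟩ := hf
  refine M.repMap_eq_zero (M.altMap (deltaRow b)) one_ne_zero (fun w _ => (one_mul _).symm) ?_
  exact fun h => M.altMap_eq_zero_of_mem_Q hbn (Ideal.mul_mem_left _ _ hQ)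

end SignedMonomials

/-- Rows describing the action of a monomial on the summands of the alternant of `genRow`. -/
def evRow (b : ℕ) : Fin n → ℤ → ℂ := fun k t =>
  if IsNegRow b k then (if t ≤ 0 then point k ^ (-t).toNat else 0)
  else (if 0 ≤ t then point k ^ t.toNat else 0)

lemma genRow_mul_evRow_of_neg (b : ℕ) (k : Fin n) {s t : ℤ} (h : s * t < 0) :
    genRow b k s * evRow b k t = 0 := by
  rw [genRow, evRow]
  rcases mul_neg_iff.1 h with h | h <;> split_ifs <;> first | omega | simp

lemma genRow_add (b : ℕ) (k : Fin n) {s t : ℤ} (h : 0 ≤ s * t) (hk : IsNegRow b k → s < 0) :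
    genRow b k (s + t) = genRow b k s * evRow b k t := by
  rw [genRow, evRow, genRow]
  by_cases hn : IsNegRow b k
  · have hs := hk hn
    have ht : t ≤ 0 := by
      by_contra ht
      push Not at ht
      linarith [mul_neg_of_neg_of_pos hs ht]
    rw [if_pos hn, if_pos hn, if_pos hn, if_pos (by omega), if_pos hs, if_pos ht, ← pow_add]
    congr 1
    omega
  · rw [if_neg hn, if_neg hn, if_neg hn]
    rcases mul_nonneg_iff.1 h with ⟨hs, ht⟩ | ⟨hs, ht⟩
    · rw [if_pos (by omega), if_pos hs, if_pos ht, ← pow_add]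
      congr 1
      omega
    · by_cases h0 : s = 0
      · subst h0; simp
      · rw [if_neg (by omega), if_neg (by omega), zero_mul]

lemma altTerm_genRow_add {b : ℕ} (hb : 1 ≤ b) (hbn : b < n) {w v : Fin n → ℤ} (hc : Compat w v)
    (hw : b ≤ (negs w).card) (τ : Equiv.Perm (Fin n)) :
    altTerm (genRow b) (w + v) τ = altTerm (genRow b) w τ * altTerm (evRow b) v τ := by
  rw [altTerm, altTerm, altTerm, ← Finset.prod_mul_distrib]
  by_cases h : ∀ k, IsNegRow b k → w (τ k) < 0
  · exact Finset.prod_congr rfl fun k _ => genRow_add b k (hc _) (h k)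
  · have hex : ∃ k ∈ negs (w ∘ τ), k ∉ Finset.univ.filter (IsNegRow b : Fin n → Prop) := by
      by_contra hcon
      push Not at hcon
      refine h fun k hk => ?_
      have heq := Finset.eq_of_subset_of_card_le (s := negs (w ∘ τ)) hcon
        (by rw [card_isNegRow hb hbn, card_negs_comp]; exact hw)
      have hk' : k ∈ negs (w ∘ τ) := by rw [heq]; simpa using hk
      exact (mem_negs (w := w ∘ τ)).1 hk'
    obtain ⟨k', hk', hn'⟩ := hex
    push Not at h
    obtain ⟨k, hk, hs⟩ := h
    rw [mem_negs, Function.comp_apply] at hk'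
    rw [Finset.mem_filter, not_and] at hn'
    have hn' := hn' (Finset.mem_univ _)
    rw [Finset.prod_eq_zero (Finset.mem_univ k'), Finset.prod_eq_zero (Finset.mem_univ k)]
    · rw [genRow, if_pos hk, if_neg (by omega), zero_mul]
    · rw [genRow, if_neg hn', if_neg]
      rcases mul_nonneg_iff.1 (hc (τ k')) with h | h <;> simp only [Pi.add_apply] <;> omega

lemma swap01_eq (hn : 1 < n) : swap01 n = Equiv.swap ⟨0, by omega⟩ ⟨1, hn⟩ := dif_pos hn

lemma sign_swap01 (hn : 1 < n) : Equiv.Perm.sign (swap01 n) = -1 := by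
  rw [swap01_eq hn, Equiv.Perm.sign_swap (by simp [Fin.ext_iff])]

lemma swap01_mul_self (hn : 1 < n) : swap01 n * swap01 n = 1 := by
  rw [swap01_eq hn, Equiv.swap_mul_self]

lemma evRow_of_point_eq_zero (b : ℕ) {k : Fin n} (hk : point k = 0) :
    evRow b k = fun t => if t = 0 then 1 else 0 := by
  funext t
  rw [evRow, hk]
  rcases lt_trichotomy t 0 with h | h | h
  · simp [h.le, h.ne, h.not_ge]
  · simp [h]
  · simp [h.le, h.ne', h.not_ge]

lemma evRow_swap01 (hn : 1 < n) (b : ℕ) (k : Fin n) :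
    evRow b (swap01 n k) = evRow b k := by
  have key : evRow b (⟨0, by omega⟩ : Fin n) = evRow b (⟨1, hn⟩ : Fin n) := by
    rw [evRow_of_point_eq_zero b (by simp [point]), evRow_of_point_eq_zero b (by simp [point])]
  rw [swap01_eq hn, Equiv.swap_apply_def]
  split_ifs with h h
  · rw [h, key]
  · rw [h, key]
  · rfl

lemma altTerm_evRow_mul_swap01 (hn : 1 < n) (b : ℕ) (w : Fin n → ℤ) (τ : Equiv.Perm (Fin n)) :
    altTerm (evRow b) w (τ * swap01 n) = altTerm (evRow b) w τ := by
  rw [altTerm, altTerm, ← Equiv.prod_comp (swap01 n)]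
  refine Finset.prod_congr rfl fun k _ => ?_
  rw [evRow_swap01 hn, ← Equiv.Perm.mul_apply, mul_assoc, swap01_mul_self hn, mul_one]

lemma two_mul_finrank_signInd_le (hn : 1 < n) :
    2 * Module.finrank ℂ (SignInd n) ≤ n.factorial := by
  have hs : ∀ τ : Equiv.Perm (Fin n),
      ((Equiv.Perm.sign τ : ℤ) : ℂ) * ((Equiv.Perm.sign τ : ℤ) : ℂ) = 1 := fun τ => by
    exact_mod_cast Int.units_coe_mul_self _
  let N : (Equiv.Perm (Fin n) → ℂ) →ₗ[ℂ] (Equiv.Perm (Fin n) → ℂ) :=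
    LinearMap.mulLeft ℂ fun τ => ((Equiv.Perm.sign τ : ℤ) : ℂ)
  have hN : Function.Injective N := by
    intro f g h
    funext τ
    have h1 : ((Equiv.Perm.sign τ : ℤ) : ℂ) * f τ = ((Equiv.Perm.sign τ : ℤ) : ℂ) * g τ :=
      congrFun h τ
    exact mul_left_cancel₀ (left_ne_zero_of_mul_eq_one (hs τ)) h1
  have hdisj : Disjoint (SignInd n) ((SignInd n).map N) := by
    rw [Submodule.disjoint_def]
    rintro _ hf ⟨g, hg, rfl⟩
    funext τ
    have h1 : ((Equiv.Perm.sign (τ * swap01 n) : ℤ) : ℂ) * g (τ * swap01 n) =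
      -(((Equiv.Perm.sign τ : ℤ) : ℂ) * g τ) := hf τ
    have h2 : g (τ * swap01 n) = -g τ := hg τ
    rw [h2, map_mul, sign_swap01 hn] at h1
    push_cast at h1
    change ((Equiv.Perm.sign τ : ℤ) : ℂ) * g τ = 0
    linear_combination h1 / 2
  have h := Submodule.finrank_add_finrank_le_of_disjoint hdisj
  rw [← (Submodule.equivMapOfInjective N hN (SignInd n)).finrank_eq,
    Module.finrank_fintype_fun_eq_card, Fintype.card_perm, Fintype.card_fin] at h
  omega

namespace SignedMonomials

variable {A : Type*} [CommRing A] [Algebra ℂ A] (M : SignedMonomials n A)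

lemma termMap_mul {b : ℕ} (hb : 1 ≤ b) (hbn : b < n) {f : A} (hf : f ∈ M.F b) (g : A)
    (τ : Equiv.Perm (Fin n)) :
    M.termMap (genRow b) (f * g) τ = M.termMap (genRow b) f τ * M.termMap (evRow b) g τ := by
  refine M.F_induction hf (fun w hw => ?_) (fun f₁ f₂ h₁ h₂ => ?_) (fun c f hf => ?_) ?_
  · refine M.induction g (fun v => ?_) (fun f₁ f₂ h₁ h₂ => ?_) (fun c f hf => ?_)
    · simp only [termMap_mon]
      by_cases hc : Compat w v
      · rw [M.mon_mul hc, termMap_mon, altTerm_genRow_add hb hbn hc hw]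
      · rw [M.mon_mul_eq_zero hc, map_zero, Pi.zero_apply, altTerm, altTerm,
          ← Finset.prod_mul_distrib]
        obtain ⟨j, hj⟩ := not_forall.1 hc
        refine (Finset.prod_eq_zero (Finset.mem_univ (τ.symm j)) ?_).symm
        rw [Equiv.apply_symm_apply]
        exact genRow_mul_evRow_of_neg b _ (not_le.1 hj)
    · simp only [mul_add, map_add, Pi.add_apply, h₁, h₂]
    · rw [mul_smul_comm, map_smul, map_smul, Pi.smul_apply, Pi.smul_apply, hf, mul_smul_comm]
  · simp only [add_mul, map_add, Pi.add_apply, h₁, h₂]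
  · rw [smul_mul_assoc, map_smul, map_smul, Pi.smul_apply, Pi.smul_apply, hf, smul_mul_assoc]
  · simp

lemma termMap_evRow_mul_swap01 (hn : 1 < n) (b : ℕ) (g : A) (τ : Equiv.Perm (Fin n)) :
    M.termMap (evRow b) g (τ * swap01 n) = M.termMap (evRow b) g τ := by
  refine M.induction g (fun v => ?_) (fun f₁ f₂ h₁ h₂ => ?_) (fun c f hf => ?_)
  · simp only [termMap_mon, altTerm_evRow_mul_swap01 hn]
  · simp only [map_add, Pi.add_apply, h₁, h₂]
  · simp only [map_smul, Pi.smul_apply, hf]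

/-- The summands of the alternant of `genRow`, antisymmetrized on the right. -/
def indMap (hn : 1 < n) (b : ℕ) : A →ₗ[ℂ] SignInd n :=
  LinearMap.codRestrict (SignInd n)
    (M.termMap (genRow b) -
      (LinearMap.funLeft ℂ ℂ (· * swap01 n)).comp (M.termMap (genRow b))) <| by
    intro f τ
    simp [LinearMap.funLeft_apply, mul_assoc, swap01_mul_self hn]

lemma coe_indMap_apply (hn : 1 < n) (b : ℕ) (f : A) (τ : Equiv.Perm (Fin n)) :
    (M.indMap hn b f : Equiv.Perm (Fin n) → ℂ) τ =
      M.termMap (genRow b) f τ - M.termMap (genRow b) f (τ * swap01 n) := rfl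

lemma indMap_perm (hn : 1 < n) (b : ℕ) (σ : Equiv.Perm (Fin n)) (f : A) :
    M.indMap hn b (M.perm σ f) = signIndAct n σ (M.indMap hn b f) := by
  refine Subtype.ext (funext fun τ => ?_)
  rw [coe_indMap_apply, termMap_perm, termMap_perm, ← mul_assoc]
  rfl

lemma altMap_genRow_mul_eq_zero {b : ℕ} (hb : 1 ≤ b) (hbn : b < n) {f : A} (hf : f ∈ M.F b)
    (hE : M.indMap (by omega) b f = 0) (g : A) : M.altMap (genRow b) (f * g) = 0 := by
  have hn : 1 < n := by omega
  have h : M.altMap (genRow b) (f * g) = -M.altMap (genRow b) (f * g) := by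
    conv_rhs => rw [altMap_eq_sum, ← Equiv.sum_comp (Equiv.mulRight (swap01 n)),
      ← Finset.sum_neg_distrib]
    rw [altMap_eq_sum]
    refine Finset.sum_congr rfl fun τ _ => ?_
    have h0 : M.termMap (genRow b) f τ - M.termMap (genRow b) f (τ * swap01 n) = 0 :=
      congrFun (congrArg Subtype.val hE) τ
    rw [Equiv.coe_mulRight, termMap_mul M hb hbn hf, termMap_mul M hb hbn hf,
      termMap_evRow_mul_swap01 M hn, ← sub_eq_zero.1 h0, map_mul, sign_swap01 hn]
    push_cast
    ring
  exact CharZero.eq_neg_self_iff.1 h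

lemma eq_zero_of_mem_range_repMap_of_indMap {b : ℕ} (hb : 1 ≤ b) (hbn : b < n) {f : A}
    (hf : f ∈ LinearMap.range (M.repMap b)) (hE : M.indMap (by omega) b f = 0) : f = 0 := by
  obtain ⟨g, rfl⟩ := hf
  refine M.repMap_eq_zero (M.altMap (genRow b)) (alt_genRow_interval_ne_zero hb hbn)
    (fun w hw => ?_) fun h => ?_
  · rw [altMap_mon, altMap_mon, alt_genRow_eq hb hbn hw]
  · rw [mul_comm]
    exact M.altMap_genRow_mul_eq_zero hb hbn (M.repMap_mem_F b g) hE h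

end SignedMonomials

namespace SignedMonomials

variable {A : Type*} [CommRing A] [Algebra ℂ A] (M : SignedMonomials n A)

/-- A smaller version of `Q b`. -/
def Q₀ (b : ℕ) : Ideal A := M.J * M.F b ⊔ M.F (b + 1)

lemma Q₀_le_Q (b : ℕ) : M.Q₀ b ≤ M.Q b :=
  sup_le_sup_right Ideal.mul_le_inf _

/-- The sum of all squarefree monomials of degree `b` in the `y` variables. -/
def elemSym (b : ℕ) : A := ∑ K ∈ Finset.powersetCard b Finset.univ, M.mon (yexp K)

lemma yexp_comp (K : Finset (Fin n)) (σ : Equiv.Perm (Fin n)) :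
    yexp K ∘ ⇑σ⁻¹ = yexp (K.map σ.toEmbedding) := by
  funext j
  simp only [yexp, Function.comp_apply]
  refine if_congr ?_ rfl rfl
  rw [Finset.mem_map_equiv]
  rfl

lemma elemSym_mem_F (b : ℕ) : M.elemSym b ∈ M.F b :=
  Ideal.sum_mem _ fun _ hK => M.mon_yexp_mem_F (Finset.mem_powersetCard.1 hK).2

lemma elemSym_mem_J {b : ℕ} (hb : 1 ≤ b) : M.elemSym b ∈ M.J := by
  refine Ideal.subset_span ⟨fun σ => ?_, ?_⟩
  · rw [elemSym, map_sum]
    refine Finset.sum_bij' (fun K _ => K.map σ.toEmbedding)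
      (fun K _ => K.map σ.symm.toEmbedding) ?_ ?_ ?_ ?_ ?_
    · intro K hK; simpa [Finset.mem_powersetCard] using hK
    · intro K hK; simpa [Finset.mem_powersetCard] using hK
    · intro K _; ext j; simp [Finset.mem_map_equiv]
    · intro K _; ext j; simp [Finset.mem_map_equiv]
    · intro K _; rw [perm_mon, yexp_comp]
  · rw [elemSym, map_sum]
    refine Finset.sum_eq_zero fun K hK => M.ev_mon fun h => ?_
    have h1 := (Finset.mem_powersetCard.1 hK).2
    rw [← negs_yexp K, h] at h1
    simp [negs] at h1
    omega

/-- A functional on `F b / Q₀ b` pairing with multiples of the monomial of exponent `v`. -/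
def pairing (b : ℕ) (v : Fin n → ℤ) : A →ₗ[ℂ] ℂ :=
  M.mon.constr ℂ fun w =>
    if negs w = negs v then M.altMap (deltaRow b) (M.mon (v - yexp (negs v)) * M.mon w) else 0

lemma pairing_mon (b : ℕ) (v w : Fin n → ℤ) : M.pairing b v (M.mon w) =
    if negs w = negs v then M.altMap (deltaRow b) (M.mon (v - yexp (negs v)) * M.mon w) else 0 :=
  M.mon.constr_basis ℂ _ _

lemma pairing_mul_mon {b : ℕ} (hbn : b < n) {v : Fin n → ℤ} (hv : (negs v).card = b)
    {w : Fin n → ℤ} (hw : b ≤ (negs w).card) (g : A) : M.pairing b v (g * M.mon w) =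
      if negs w = negs v then M.altMap (deltaRow b) (M.mon (v - yexp (negs v)) * (g * M.mon w))
      else 0 := by
  refine M.induction g (fun u => ?_) (fun f g hf hg => ?_) fun c f hf => ?_
  · by_cases hc : Compat u w
    · rw [M.mon_mul hc, pairing_mon, negs_add hc]
      by_cases hwv : negs w = negs v
      · rw [if_pos hwv, hwv]
        split_ifs with h
        · rfl
        · refine (M.altMap_eq_zero_of_mem_F hbn (Ideal.mul_mem_left _ _ (M.mon_mem_F ?_))).symm
          rw [negs_add hc, hwv, ← hv]
          exact Finset.card_lt_card (Finset.ssubset_iff_subset_ne.2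
            ⟨Finset.subset_union_right, fun h' => h h'.symm⟩)
      · rw [if_neg hwv, if_neg]
        intro h
        exact hwv (Finset.eq_of_subset_of_card_le (h ▸ Finset.subset_union_right) (by omega))
    · rw [M.mon_mul_eq_zero hc, mul_zero, map_zero, map_zero, ite_self]
  · rw [add_mul, map_add, hf, hg, mul_add, map_add]
    split_ifs <;> simp
  · rw [smul_mul_assoc, map_smul, hf, mul_smul_comm, map_smul]
    split_ifs <;> simp

lemma pairing_eq_zero_of_mem_Q₀ {b : ℕ} (hbn : b < n) {v : Fin n → ℤ} (hv : (negs v).card = b)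
    {f : A} (hf : f ∈ M.Q₀ b) : M.pairing b v f = 0 := by
  obtain ⟨g, hg, h, hh, rfl⟩ := Submodule.mem_sup.1 hf
  rw [map_add]
  have h1 : M.pairing b v g = 0 := by
    clear hf
    induction hg using Submodule.mul_induction_on' with
    | mem_mul_mem s hs f hf =>
      refine M.F_induction hf (fun w hw => ?_) (fun f g hf hg => ?_) (fun c f hf => ?_) ?_
      · rw [M.pairing_mul_mon hbn hv hw]
        split_ifs
        · exact M.altMap_eq_zero_of_mem_J hbn
            (Ideal.mul_mem_left _ _ (Ideal.mul_mem_right _ _ hs))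
        · rfl
      · rw [mul_add, map_add, hf, hg, add_zero]
      · rw [mul_smul_comm, map_smul, hf, smul_zero]
      · simp
    | add f _ g _ hf hg => rw [map_add, hf, hg, add_zero]
  have h2 : M.pairing b v h = 0 := by
    refine M.F_induction hh (fun w hw => ?_) (fun f g hf hg => ?_) (fun c f hf => ?_) (map_zero _)
    · rw [pairing_mon, if_neg]
      intro h
      rw [h] at hw
      omega
    · rw [map_add, hf, hg, add_zero]
    · rw [map_smul, hf, smul_zero]
  rw [h1, h2, add_zero]

lemma pairing_mul_elemSym {b : ℕ} (hbn : b < n) {v : Fin n → ℤ} (hv : (negs v).card = b) (g : A) :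
    M.pairing b v (g * M.elemSym b) = M.altMap (deltaRow b) (g * M.mon v) := by
  rw [elemSym, Finset.mul_sum, map_sum, Finset.sum_eq_single (negs v)]
  · rw [M.pairing_mul_mon hbn hv (by rw [negs_yexp, hv]), if_pos (negs_yexp _), mul_left_comm,
      M.mon_sub_yexp_mul subset_rfl]
  · intro K hK hne
    rw [M.pairing_mul_mon hbn hv (by rw [negs_yexp, (Finset.mem_powersetCard.1 hK).2]),
      if_neg (by rwa [negs_yexp])]
  · intro h
    exact absurd (Finset.mem_powersetCard.2 ⟨Finset.subset_univ _, hv⟩) h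

lemma length_le_finrank_map_Q {a b : ℕ} (hab : a + b = n) (ha : 1 ≤ a) (hb : 1 ≤ b)
    {l : List ((Fin n → ℤ) × (Fin n → ℤ))} (hl : ∀ p ∈ l, (negs p.2).card = b)
    (ht : Triangular (fullVals b a) l)
    [FiniteDimensional ℂ (((M.Q b).restrictScalars ℂ).map ((M.Q₀ b).restrictScalars ℂ).mkQ)] :
    l.length ≤ Module.finrank ℂ
      (((M.Q b).restrictScalars ℂ).map ((M.Q₀ b).restrictScalars ℂ).mkQ) := by
  classical
  have hbn : b < n := by omega
  let ψ : (Fin n → ℤ) → Module.Dual ℂ (A ⧸ (M.Q₀ b).restrictScalars ℂ) := fun v =>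
    if hv : (negs v).card = b then
      ((M.Q₀ b).restrictScalars ℂ).liftQ (M.pairing b v)
        fun f hf => M.pairing_eq_zero_of_mem_Q₀ hbn hv hf
    else 0
  have hψ : ∀ v, (negs v).card = b → ∀ g, ψ v (((M.Q₀ b).restrictScalars ℂ).mkQ
      (g * M.elemSym b)) = M.altMap (deltaRow b) (g * M.mon v) := by
    intro v hv g
    simp only [ψ]
    rw [dif_pos hv]
    exact M.pairing_mul_elemSym hbn hv g
  have h := length_le_finrank
    (l.map fun p => (((M.Q₀ b).restrictScalars ℂ).mkQ (M.mon p.1 * M.elemSym b), ψ p.2))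
    (((M.Q b).restrictScalars ℂ).map ((M.Q₀ b).restrictScalars ℂ).mkQ) ?_ ?_
  · rwa [List.length_map] at h
  · intro q hq
    obtain ⟨p, hp, rfl⟩ := List.mem_map.1 hq
    refine ⟨Submodule.mem_map_of_mem (Ideal.mul_mem_left _ _ (Ideal.mem_sup_left
      ⟨M.elemSym_mem_J hb, M.elemSym_mem_F b⟩)), ?_⟩
    rw [hψ _ (hl p hp)]
    exact (M.altMap_ne_zero_iff hab).2 (ht.1 p hp)
  · rw [List.pairwise_map]
    refine (List.pairwise_iff_forall_sublist.2 fun {p q} hs => ?_)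
    have hp := hl p (hs.subset List.mem_cons_self)
    have hg := List.pairwise_iff_forall_sublist.1 ht.2 hs
    rw [hψ _ hp]
    by_contra hne
    exact hg ((M.altMap_ne_zero_iff hab).1 hne)

end SignedMonomials

section

open Polynomial

variable {C : Type*} [CommRing C] [Algebra ℂ C]

lemma exists_subalgebra_adjoin (A₀ : Subalgebra ℂ C) [FiniteDimensional ℂ A₀] (z : C)
    {P : C[X]} (hP : P.Monic) (hcoeff : ∀ i, P.coeff i ∈ A₀) (hz : P.eval z = 0) :
    ∃ A₁ : Subalgebra ℂ C, A₀ ≤ A₁ ∧ z ∈ A₁ ∧ FiniteDimensional ℂ A₁ ∧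
      Module.finrank ℂ A₁ ≤ Module.finrank ℂ A₀ * P.natDegree := by
  cases subsingleton_or_nontrivial C with
  | inl h =>
    refine ⟨A₀, le_rfl, ?_, inferInstance, ?_⟩
    · rw [Subsingleton.elim z 0]; exact zero_mem _
    · have : Module.finrank ℂ A₀ = 0 := Module.finrank_zero_of_subsingleton
      omega
  | inr h =>
  have hlift : P ∈ Polynomial.lifts (algebraMap A₀ C) := by
    rw [Polynomial.lifts_iff_coeff_lifts]
    exact fun i => ⟨⟨_, hcoeff i⟩, rfl⟩
  obtain ⟨P₀, hmap, hdeg, hmon⟩ := Polynomial.lifts_and_natDegree_eq_and_monic hlift hP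
  have hroot : Polynomial.aeval z P₀ = 0 := by
    rw [Polynomial.aeval_def, ← Polynomial.eval_map, hmap, hz]
  let φ : (Fin P.natDegree → A₀) →ₗ[ℂ] C :=
    ∑ i : Fin P.natDegree,
      ((LinearMap.mulRight ℂ (z ^ (i : ℕ))).comp A₀.val.toLinearMap).comp (LinearMap.proj i)
  have hφ : ∀ c, φ c = ∑ i, (c i : C) * z ^ (i : ℕ) := fun c => by
    simp [φ, LinearMap.sum_apply]
  have hle : Subalgebra.toSubmodule ((Algebra.adjoin A₀ {z}).restrictScalars ℂ) ≤
      LinearMap.range φ := by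
    intro x hx
    replace hx : x ∈ Algebra.adjoin A₀ {z} := hx
    rw [Algebra.adjoin_singleton_eq_range_aeval] at hx
    obtain ⟨p, rfl⟩ := hx
    refine ⟨fun i => (p %ₘ P₀).coeff i, ?_⟩
    rw [hφ]
    change _ = Polynomial.aeval z p
    rw [← Polynomial.aeval_modByMonic_eq_self_of_root hroot]
    by_cases hd : P.natDegree = 0
    · have h1 : P₀ = 1 := (Polynomial.Monic.natDegree_eq_zero hmon).1 (hdeg.trans hd)
      rw [h1, Polynomial.modByMonic_one, map_zero]
      exact Finset.sum_eq_zero fun i _ => by simp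
    · rw [Polynomial.aeval_eq_sum_range' (n := P.natDegree), Finset.sum_range]
      · rfl
      · rw [← hdeg]
        refine Polynomial.natDegree_modByMonic_lt _ hmon fun h1 => hd ?_
        rw [← hdeg, h1, Polynomial.natDegree_one]
  have hfin := Submodule.finiteDimensional_of_le hle
  refine ⟨(Algebra.adjoin A₀ {z}).restrictScalars ℂ, ?_, ?_, hfin, ?_⟩
  · intro x hx
    rw [Subalgebra.mem_restrictScalars]
    exact (Algebra.adjoin A₀ {z}).algebraMap_mem (⟨x, hx⟩ : A₀)
  · rw [Subalgebra.mem_restrictScalars]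
    exact Algebra.self_mem_adjoin_singleton A₀ z
  · refine (Submodule.finrank_mono hle).trans ((LinearMap.finrank_range_le φ).trans ?_)
    rw [Module.finrank_pi_fintype]
    simp [mul_comm]

lemma coeff_mem_of_mul_coeff_mem {A₁ : Subalgebra ℂ C} {z : C} (hz : z ∈ A₁) {P : C[X]}
    (h : ∀ i, ((Polynomial.X - Polynomial.C z) * P).coeff i ∈ A₁) (i : ℕ) : P.coeff i ∈ A₁ := by
  suffices H : ∀ k i, P.natDegree < i + k → P.coeff i ∈ A₁ from H (P.natDegree + 1) i (by omega)
  intro k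
  induction k with
  | zero =>
    intro i hi
    rw [Polynomial.coeff_eq_zero_of_natDegree_lt (by omega)]
    exact zero_mem _
  | succ k ih =>
    intro i hi
    have h1 := h (i + 1)
    rw [sub_mul, Polynomial.coeff_sub, Polynomial.coeff_X_mul, Polynomial.coeff_C_mul] at h1
    have h2 := A₁.add_mem h1 (A₁.mul_mem hz (ih (i + 1) (by omega)))
    rwa [sub_add_cancel] at h2

/-- Adjoining the roots of a split polynomial of degree `m` multiplies the dimension by at most
`m!`. -/
lemma exists_subalgebra_adjoin_roots {ι : Type*} (f : ι → C) (K : Finset ι)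
    (A₀ : Subalgebra ℂ C) [FiniteDimensional ℂ A₀]
    (h : ∀ i, (∏ j ∈ K, (Polynomial.X - Polynomial.C (f j))).coeff i ∈ A₀) :
    ∃ A₁ : Subalgebra ℂ C, A₀ ≤ A₁ ∧ (∀ j ∈ K, f j ∈ A₁) ∧ FiniteDimensional ℂ A₁ ∧
      Module.finrank ℂ A₁ ≤ Module.finrank ℂ A₀ * K.card.factorial := by
  classical
  induction K using Finset.induction_on generalizing A₀ with
  | empty => exact ⟨A₀, le_rfl, by simp, inferInstance, by simp⟩
  | insert j K hj ih =>
    cases subsingleton_or_nontrivial C with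
    | inl hs =>
      refine ⟨A₀, le_rfl, fun k _ => ?_, inferInstance,
        Nat.le_mul_of_pos_right _ (Nat.factorial_pos _)⟩
      rw [Subsingleton.elim (f k) 0]; exact zero_mem _
    | inr hs =>
    obtain ⟨A₁, h01, hjA, hfin, hrank⟩ := exists_subalgebra_adjoin A₀ (f j)
      (Polynomial.monic_prod_X_sub_C f (insert j K)) h (by
        rw [Polynomial.eval_prod]
        exact Finset.prod_eq_zero (Finset.mem_insert_self j K) (by simp))
    obtain ⟨A₂, h12, hK, hfin', hrank'⟩ := ih A₁ fun i => by
      refine coeff_mem_of_mul_coeff_mem hjA (fun i => h01 ?_) i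
      have h1 := h i
      rwa [Finset.prod_insert hj] at h1
    refine ⟨A₂, h01.trans h12, ?_, hfin', hrank'.trans ?_⟩
    · intro k hk
      rcases Finset.mem_insert.1 hk with rfl | hk
      · exact h12 hjA
      · exact hK k hk
    · rw [Polynomial.natDegree_finsetProd_X_sub_C_eq_card, Finset.card_insert_of_notMem hj] at hrank
      rw [Finset.card_insert_of_notMem hj, Nat.factorial_succ, ← mul_assoc]
      exact Nat.mul_le_mul_right _ hrank

/-- An algebra generated by the roots of two polynomials with scalar coefficients. -/
lemma finrank_le_of_roots {ι : Type*} (f : ι → C) (K L : Finset ι)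
    (hK : ∏ j ∈ K, (Polynomial.X - Polynomial.C (f j)) = Polynomial.X ^ K.card)
    (hL : ∏ j ∈ L, (Polynomial.X - Polynomial.C (f j)) = Polynomial.X ^ L.card)
    (hgen : ∀ S : Subalgebra ℂ C, (∀ j ∈ K, f j ∈ S) → (∀ j ∈ L, f j ∈ S) → S = ⊤) :
    FiniteDimensional ℂ C ∧ Module.finrank ℂ C ≤ K.card.factorial * L.card.factorial := by
  have hX : ∀ (S : Subalgebra ℂ C) (m i : ℕ), ((Polynomial.X : C[X]) ^ m).coeff i ∈ S := by
    intro S m i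
    rw [Polynomial.coeff_X_pow]
    split_ifs
    · exact one_mem _
    · exact zero_mem _
  obtain ⟨A₁, -, h1, hfin, hrank⟩ := exists_subalgebra_adjoin_roots f K ⊥
    fun i => by rw [hK]; exact hX _ _ _
  obtain ⟨A₂, h12, h2, hfin', hrank'⟩ := exists_subalgebra_adjoin_roots f L A₁
    fun i => by rw [hL]; exact hX _ _ _
  have htop := hgen A₂ (fun j hj => h12 (h1 j hj)) h2
  subst htop
  have hbot : Module.finrank ℂ (⊥ : Subalgebra ℂ C) ≤ 1 := by
    cases subsingleton_or_nontrivial C with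
    | inl h => rw [Module.finrank_zero_of_subsingleton]; exact zero_le_one
    | inr h => rw [Subalgebra.finrank_bot]
  refine ⟨Module.Finite.equiv (Subalgebra.topEquiv (R := ℂ) (A := C)).toLinearEquiv, ?_⟩
  rw [← (Subalgebra.topEquiv (R := ℂ) (A := C)).toLinearEquiv.finrank_eq]
  refine hrank'.trans (Nat.mul_le_mul_right _ (hrank.trans ?_))
  exact (Nat.mul_le_mul_right _ hbot).trans (one_mul _).le

end

lemma finrank_sup_le {V ι : Type*} [AddCommGroup V] [Module ℂ V] (s : Finset ι)
    (W : ι → Submodule ℂ V) (d : ℕ)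
    (h : ∀ i ∈ s, FiniteDimensional ℂ (W i) ∧ Module.finrank ℂ (W i) ≤ d) :
    FiniteDimensional ℂ ↥(s.sup W) ∧ Module.finrank ℂ ↥(s.sup W) ≤ s.card * d := by
  classical
  induction s using Finset.induction_on with
  | empty => rw [Finset.sup_empty]; exact ⟨inferInstance, by simp⟩
  | insert i s hi ih =>
    obtain ⟨h1, h2⟩ := ih fun j hj => h j (Finset.mem_insert_of_mem hj)
    obtain ⟨h3, h4⟩ := h i (Finset.mem_insert_self i s)
    rw [Finset.sup_insert]
    refine ⟨inferInstance, (Submodule.finrank_add_le_finrank_add_finrank _ _).trans ?_⟩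
    rw [Finset.card_insert_of_notMem hi, add_mul, one_mul]
    omega

namespace SignedMonomials

variable {A : Type*} [CommRing A] [Algebra ℂ A] (M : SignedMonomials n A)

lemma mem_of_forall_single_mem (S : Subalgebra ℂ A)
    (h : ∀ j (ε : ℤ), ε = 1 ∨ ε = -1 → M.mon (Pi.single j ε) ∈ S) (f : A) : f ∈ S := by
  refine M.induction f (fun w => ?_) (fun f g hf hg => add_mem hf hg)
    fun c f hf => S.smul_mem hf c
  induction hd : deg w using Nat.strong_induction_on generalizing w with
  | _ d ih =>
    by_cases hw : w = 0
    · rw [hw, M.mon_zero]; exact one_mem S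
    · obtain ⟨j, hj⟩ := Function.ne_iff.1 hw
      rw [Pi.zero_apply] at hj
      obtain ⟨ε, hε, hpos⟩ : ∃ ε : ℤ, (ε = 1 ∨ ε = -1) ∧ 0 ≤ (w j - ε) * ε := by
        rcases lt_or_gt_of_ne hj with h | h
        · exact ⟨-1, Or.inr rfl, by linarith⟩
        · exact ⟨1, Or.inl rfl, by linarith⟩
      have hc : Compat (w - Pi.single j ε) (Pi.single j ε) := by
        intro k
        by_cases hk : k = j
        · subst hk; simpa using hpos
        · simp [hk]
      have hdeg : deg (w - Pi.single j ε) + 1 = d := by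
        have h1 := deg_add hc
        have h2 : deg (Pi.single j ε : Fin n → ℤ) = 1 := by
          rw [deg, Finset.sum_eq_single j]
          · rcases hε with rfl | rfl <;> simp
          · intro k _ hk; simp [hk]
          · simp
        rw [sub_add_cancel, h2, hd] at h1
        exact h1.symm
      rw [← sub_add_cancel w (Pi.single j ε), ← M.mon_mul hc]
      exact S.mul_mem (ih _ (by omega) _ rfl) (h j ε hε)

lemma prod_X_sub_C_eq {C : Type*} [CommRing C] (π : A →+* C) (hπ : ∀ f ∈ M.J, π f = 0)
    {ε : ℤ} (hε : ε ≠ 0) :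
    ∏ j, (Polynomial.X - Polynomial.C (π (M.mon (Pi.single j ε)))) = Polynomial.X ^ n := by
  set P : Polynomial A := ∏ j, (Polynomial.X - Polynomial.C (M.mon (Pi.single j ε))) with hP
  have hinv : ∀ σ, P.map (M.perm σ : A →+* A) = P := by
    intro σ
    rw [hP, Polynomial.map_prod]
    conv_rhs => rw [← Equiv.prod_comp σ]
    refine Finset.prod_congr rfl fun j _ => ?_
    rw [Polynomial.map_sub, Polynomial.map_X, Polynomial.map_C, RingHom.coe_coe, perm_mon]
    congr 3
    funext k
    simp only [Function.comp_apply, Pi.single_apply, Equiv.Perm.inv_def, Equiv.symm_apply_eq]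
  have hev : P.map (M.ev : A →+* ℂ) = Polynomial.X ^ n := by
    rw [hP, Polynomial.map_prod, Finset.prod_congr rfl (g := fun _ => Polynomial.X)]
    · simp
    · intro j _
      rw [Polynomial.map_sub, Polynomial.map_X, Polynomial.map_C, RingHom.coe_coe, M.ev_mon,
        map_zero, sub_zero]
      exact fun h => hε (by simpa using congrFun h j)
  have hmap : ∏ j, (Polynomial.X - Polynomial.C (π (M.mon (Pi.single j ε)))) = P.map π := by
    rw [hP, Polynomial.map_prod]
    simp
  rw [hmap]
  ext i
  have hJ : (P - Polynomial.X ^ n).coeff i ∈ M.J := by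
    refine Ideal.subset_span ⟨fun σ => ?_, ?_⟩
    · have h1 : ((P - Polynomial.X ^ n).map (M.perm σ : A →+* A)).coeff i =
          (P - Polynomial.X ^ n).coeff i := by
        rw [Polynomial.map_sub, hinv, Polynomial.map_pow, Polynomial.map_X]
      rwa [Polynomial.coeff_map] at h1
    · have h1 : ((P - Polynomial.X ^ n).map (M.ev : A →+* ℂ)).coeff i = 0 := by
        rw [Polynomial.map_sub, hev, Polynomial.map_pow, Polynomial.map_X, sub_self,
          Polynomial.coeff_zero]
      rwa [Polynomial.coeff_map] at h1
  have h2 := hπ _ hJ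
  rw [← Polynomial.coeff_map, Polynomial.map_sub, Polynomial.map_pow, Polynomial.map_X,
    Polynomial.coeff_sub] at h2
  exact sub_eq_zero.1 h2

lemma prod_X_sub_C_eq_of_eq_zero {C : Type*} [CommRing C] (π : A →+* C)
    (hπ : ∀ f ∈ M.J, π f = 0) {ε : ℤ} (hε : ε ≠ 0) (K : Finset (Fin n))
    (hK : ∀ j ∉ K, π (M.mon (Pi.single j ε)) = 0) :
    ∏ j ∈ K, (Polynomial.X - Polynomial.C (π (M.mon (Pi.single j ε)))) =
      Polynomial.X ^ K.card := by
  have h := M.prod_X_sub_C_eq π hπ hε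
  rw [← Finset.prod_mul_prod_compl K, Finset.prod_congr rfl (s₁ := Kᶜ)
    (g := fun _ => (Polynomial.X : Polynomial C)), Finset.prod_const] at h
  · refine (Polynomial.monic_X_pow Kᶜ.card).isRegular.right ?_
    change _ * _ = _ * _
    rw [h, ← pow_add, Finset.card_add_card_compl, Fintype.card_fin]
  · intro j hj
    rw [hK j (Finset.mem_compl.1 hj), map_zero, sub_zero]

/-- The elements carrying the monomial of exponent `yexp K` into `Q₀ b`. -/
def colonIdeal (b : ℕ) (K : Finset (Fin n)) : Ideal A :=
  Submodule.comap (LinearMap.mulRight A (M.mon (yexp K))) (M.Q₀ b)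

lemma mem_colonIdeal {b : ℕ} {K : Finset (Fin n)} {f : A} :
    f ∈ M.colonIdeal b K ↔ f * M.mon (yexp K) ∈ M.Q₀ b := Iff.rfl

lemma finrank_quotient_colonIdeal_le {b : ℕ} {K : Finset (Fin n)} (hK : K.card = b) :
    FiniteDimensional ℂ (A ⧸ M.colonIdeal b K) ∧
      Module.finrank ℂ (A ⧸ M.colonIdeal b K) ≤ b.factorial * (n - b).factorial := by
  classical
  let π := Ideal.Quotient.mk (M.colonIdeal b K)
  have hπ : ∀ f ∈ M.J, π f = 0 := by
    intro f hf
    rw [Ideal.Quotient.eq_zero_iff_mem, mem_colonIdeal]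
    exact Ideal.mem_sup_left (Ideal.mul_mem_mul hf (M.mon_yexp_mem_F hK))
  have hy : ∀ j ∉ K, π (M.mon (Pi.single j (-1))) = 0 := by
    intro j hj
    rw [Ideal.Quotient.eq_zero_iff_mem, mem_colonIdeal]
    have hc : Compat (Pi.single j (-1)) (yexp K) := by
      intro k
      by_cases hk : k = j
      · subst hk; simp [yexp, hj]
      · simp [hk]
    rw [M.mon_mul hc]
    refine Ideal.mem_sup_right (M.mon_mem_F ?_)
    rw [negs_add hc, negs_yexp, ← hK, Nat.succ_le_iff]
    refine Finset.card_lt_card (Finset.ssubset_iff_subset_ne.2 ⟨Finset.subset_union_right, ?_⟩)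
    intro h
    refine hj ?_
    rw [h, Finset.mem_union, mem_negs]
    simp
  have hx : ∀ j ∉ Kᶜ, π (M.mon (Pi.single j 1)) = 0 := by
    intro j hj
    rw [Finset.mem_compl, not_not] at hj
    rw [Ideal.Quotient.eq_zero_iff_mem, mem_colonIdeal, M.mon_mul_eq_zero]
    · exact zero_mem _
    · intro h
      have := h j
      simp [yexp, hj] at this
  let f : Fin n → A ⧸ M.colonIdeal b K := fun j =>
    if j ∈ K then π (M.mon (Pi.single j (-1))) else π (M.mon (Pi.single j 1))
  have h := finrank_le_of_roots f K Kᶜ ?_ ?_ ?_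
  · rwa [Finset.card_compl, Fintype.card_fin, hK] at h
  · rw [← M.prod_X_sub_C_eq_of_eq_zero π hπ (by decide) K hy]
    exact Finset.prod_congr rfl fun j hj => by simp only [f, if_pos hj]
  · rw [← M.prod_X_sub_C_eq_of_eq_zero π hπ one_ne_zero Kᶜ hx]
    exact Finset.prod_congr rfl fun j hj => by simp only [f, if_neg (Finset.mem_compl.1 hj)]
  · intro S hS hS'
    rw [eq_top_iff]
    intro c _
    obtain ⟨g, rfl⟩ := Ideal.Quotient.mk_surjective c
    refine M.mem_of_forall_single_mem (S.comap (Ideal.Quotient.mkₐ ℂ (M.colonIdeal b K))) ?_ g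
    intro j ε hε
    rw [Subalgebra.mem_comap, Ideal.Quotient.mkₐ_eq_mk]
    by_cases hj : j ∈ K
    · rcases hε with rfl | rfl
      · have h0 := hx j (by simpa using hj)
        simp only [π] at h0
        rw [h0]; exact zero_mem S
      · have h0 := hS j hj
        simp only [f, if_pos hj] at h0
        exact h0
    · rcases hε with rfl | rfl
      · have h0 := hS' j (Finset.mem_compl.2 hj)
        simp only [f, if_neg hj] at h0
        exact h0
      · have h0 := hy j hj
        simp only [π] at h0
        rw [h0]; exact zero_mem S

lemma finrank_map_F_le {b : ℕ} (hbn : b ≤ n) :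
    FiniteDimensional ℂ (((M.F b).restrictScalars ℂ).map ((M.Q₀ b).restrictScalars ℂ).mkQ) ∧
      Module.finrank ℂ (((M.F b).restrictScalars ℂ).map ((M.Q₀ b).restrictScalars ℂ).mkQ) ≤
        n.factorial := by
  set q := ((M.Q₀ b).restrictScalars ℂ).mkQ
  let φ : Finset (Fin n) → A →ₗ[ℂ] (A ⧸ (M.Q₀ b).restrictScalars ℂ) := fun K =>
    q.comp (LinearMap.mulRight ℂ (M.mon (yexp K)))
  have hker : ∀ K, LinearMap.ker (φ K) = (M.colonIdeal b K).restrictScalars ℂ := by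
    intro K
    ext f
    rw [LinearMap.mem_ker, Submodule.restrictScalars_mem, mem_colonIdeal]
    exact Submodule.Quotient.mk_eq_zero _
  obtain ⟨h1, h2⟩ := finrank_sup_le (Finset.powersetCard b (Finset.univ : Finset (Fin n)))
    (fun K => LinearMap.range (φ K)) (b.factorial * (n - b).factorial) <| by
      intro K hK
      obtain ⟨h1, h2⟩ := M.finrank_quotient_colonIdeal_le (Finset.mem_powersetCard.1 hK).2
      let e : LinearMap.range (φ K) ≃ₗ[ℂ] A ⧸ M.colonIdeal b K :=
        (φ K).quotKerEquivRange.symm ≪≫ₗ Submodule.quotEquivOfEq _ _ (hker K) ≪≫ₗ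
          Submodule.Quotient.restrictScalarsEquiv ℂ _
      exact ⟨Module.Finite.equiv e.symm, e.finrank_eq.trans_le h2⟩
  have hle : ((M.F b).restrictScalars ℂ).map q ≤
      (Finset.powersetCard b (Finset.univ : Finset (Fin n))).sup
        fun K => LinearMap.range (φ K) := by
    rintro _ ⟨f, hf, rfl⟩
    refine M.F_induction (f := f) hf (fun w hw => ?_) (fun f g hf hg => ?_) (fun c f hf => ?_) ?_
    · obtain ⟨K, hK, hc⟩ := Finset.exists_subset_card_eq hw
      rw [← M.mon_sub_yexp_mul hK]
      exact Finset.le_sup (f := fun K => LinearMap.range (φ K))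
        (Finset.mem_powersetCard.2 ⟨Finset.subset_univ K, hc⟩) ⟨_, rfl⟩
    · rw [map_add]; exact add_mem hf hg
    · rw [map_smul]; exact Submodule.smul_mem _ c hf
    · rw [map_zero]; exact zero_mem _
  refine ⟨Submodule.finiteDimensional_of_le hle, (Submodule.finrank_mono hle).trans (h2.trans ?_)⟩
  rw [Finset.card_powersetCard, Finset.card_univ, Fintype.card_fin, ← mul_assoc,
    Nat.choose_mul_factorial_mul_factorial hbn]

end SignedMonomials

namespace SignedMonomials

variable {A : Type*} [CommRing A] [Algebra ℂ A] (M : SignedMonomials n A)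

lemma mem_range_sup_of_mem_F {a b : ℕ} (hab : a + b = n) (ha : 1 ≤ a) (hb : 1 ≤ b)
    {l : List ((Fin n → ℤ) × (Fin n → ℤ))} (hlen : 2 * l.length = n.factorial)
    (hl : ∀ p ∈ l, (negs p.2).card = b) (ht : Triangular (fullVals b a) l) {f : A}
    (hf : f ∈ M.F b) : ∃ g ∈ LinearMap.range (M.repMap b), f - g ∈ M.Q b := by
  have hbn : b < n := by omega
  set q := ((M.Q₀ b).restrictScalars ℂ).mkQ
  have hq : ∀ f, q f = 0 ↔ f ∈ M.Q₀ b := fun f => Submodule.Quotient.mk_eq_zero _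
  set R := (LinearMap.range (M.repMap b)).map q
  set Q := ((M.Q b).restrictScalars ℂ).map q
  set F := ((M.F b).restrictScalars ℂ).map q
  obtain ⟨hfin, hF⟩ : FiniteDimensional ℂ F ∧ Module.finrank ℂ F ≤ n.factorial :=
    M.finrank_map_F_le hbn.le
  have hRF : R ≤ F := Submodule.map_mono <| by
    rintro _ ⟨g, rfl⟩
    exact M.repMap_mem_F b g
  have hQF : Q ≤ F := by
    rintro _ ⟨f, hf, rfl⟩
    obtain ⟨g, hg, h, hh, rfl⟩ := Submodule.mem_sup.1 hf
    rw [map_add, (hq h).2 (Ideal.mem_sup_right hh), add_zero]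
    exact Submodule.mem_map_of_mem hg.2
  have hfinQ : FiniteDimensional ℂ Q := Submodule.finiteDimensional_of_le hQF
  have hfinR : FiniteDimensional ℂ R := Submodule.finiteDimensional_of_le hRF
  have hdisj : Disjoint R Q := by
    rw [Submodule.disjoint_def]
    rintro _ ⟨g, hg, rfl⟩ ⟨f, hf, hfg⟩
    have h1 : g - f ∈ M.Q b := M.Q₀_le_Q b ((hq _).1 (by rw [map_sub, hfg, sub_self]))
    have h2 := add_mem h1 hf
    rw [sub_add_cancel] at h2
    rw [M.eq_zero_of_mem_range_repMap_of_mem_Q hbn hg h2, map_zero]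
  have hR : l.length ≤ Module.finrank ℂ R := by
    refine (M.length_le_finrank_range_repMap hab hl ht).trans_eq ?_
    refine (LinearEquiv.ofBijective (q.submoduleMap _) ⟨?_, q.submoduleMap_surjective _⟩).finrank_eq
    rw [injective_iff_map_eq_zero]
    rintro ⟨g, hg⟩ h
    have h1 : q g = 0 := congrArg Subtype.val h
    exact Subtype.ext (M.eq_zero_of_mem_range_repMap_of_mem_Q hbn hg (M.Q₀_le_Q b ((hq g).1 h1)))
  have hQ : l.length ≤ Module.finrank ℂ Q := M.length_le_finrank_map_Q hab ha hb hl ht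
  have hsum : Module.finrank ℂ ↥(R ⊔ Q) = Module.finrank ℂ R + Module.finrank ℂ Q := by
    rw [← Submodule.finrank_sup_add_finrank_inf_eq, hdisj.eq_bot, finrank_bot, add_zero]
  have heq : R ⊔ Q = F :=
    Submodule.eq_of_le_of_finrank_le (sup_le hRF hQF) (by rw [hsum]; omega)
  have hfF : q f ∈ R ⊔ Q := by rw [heq]; exact Submodule.mem_map_of_mem hf
  obtain ⟨_, ⟨g, hg, rfl⟩, _, ⟨h, hh, rfl⟩, hgh⟩ := Submodule.mem_sup.1 hfF
  refine ⟨g, hg, ?_⟩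
  have h1 : f - g - h ∈ M.Q b := M.Q₀_le_Q b ((hq _).1 (by
    rw [map_sub, map_sub, ← hgh, add_sub_cancel_left, sub_self]))
  have h2 := add_mem h1 hh
  rwa [sub_add_cancel] at h2

/-- The quotient `F b / Q b`. -/
abbrev Graded (b : ℕ) : Type _ :=
  ↥((M.F b).restrictScalars ℂ) ⧸
    Submodule.comap ((M.F b).restrictScalars ℂ).subtype ((M.Q b).restrictScalars ℂ)

theorem exists_graded_equiv {b : ℕ} (hb : 1 ≤ b) (hbn : b < n) :
    ∃ e : M.Graded b ≃ₗ[ℂ] SignInd n,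
      (∀ (σ : Equiv.Perm (Fin n)) (f : A) (hf : f ∈ M.F b) (hσ : M.perm σ f ∈ M.F b),
        e (Submodule.Quotient.mk ⟨M.perm σ f, hσ⟩) =
          signIndAct n σ (e (Submodule.Quotient.mk ⟨f, hf⟩))) ∧
      2 * Module.finrank ℂ (M.Graded b) = n.factorial := by
  have hn : 1 < n := by omega
  obtain ⟨l, hlen, hl, ht⟩ := exists_full_list n (n - b) b (by omega) (by omega) hb
  set R := LinearMap.range (M.repMap b)
  have hRF : ∀ g : R, (g : A) ∈ M.F b := by
    rintro ⟨_, g, rfl⟩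
    exact M.repMap_mem_F b g
  let Φ : R →ₗ[ℂ] M.Graded b :=
    (Submodule.mkQ _).comp (LinearMap.codRestrict ((M.F b).restrictScalars ℂ) R.subtype hRF)
  have hΦ : ∀ (g : R) (f : A) (hf : f ∈ M.F b),
      Φ g = Submodule.Quotient.mk ⟨f, hf⟩ ↔ (g : A) - f ∈ M.Q b :=
    fun g f hf => Submodule.Quotient.eq _
  have hΦb : Function.Bijective Φ := by
    constructor
    · rw [injective_iff_map_eq_zero]
      intro g hg
      have h1 := (hΦ g 0 (zero_mem _)).1 hg
      rw [sub_zero] at h1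
      exact Subtype.ext (M.eq_zero_of_mem_range_repMap_of_mem_Q hbn g.2 h1)
    · intro y
      obtain ⟨⟨f, hf⟩, rfl⟩ := Submodule.Quotient.mk_surjective _ y
      obtain ⟨g, hg, hfg⟩ := M.mem_range_sup_of_mem_F (a := n - b) (by omega) (by omega) hb hlen
        hl ht hf
      refine ⟨⟨g, hg⟩, (hΦ _ _ _).2 ?_⟩
      rw [← neg_sub]
      exact neg_mem hfg
  let Ψ : R →ₗ[ℂ] SignInd n := (M.indMap hn b).comp R.subtype
  have hΨi : Function.Injective Ψ := by
    rw [injective_iff_map_eq_zero]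
    intro g hg
    exact Subtype.ext (M.eq_zero_of_mem_range_repMap_of_indMap hb hbn g.2 hg)
  have hR : l.length ≤ Module.finrank ℂ R :=
    M.length_le_finrank_range_repMap (a := n - b) (by omega) hl ht
  have hS := two_mul_finrank_signInd_le hn
  have hRS := LinearMap.finrank_le_finrank_of_injective hΨi
  have hΨb : Function.Bijective Ψ :=
    ⟨hΨi, (LinearMap.injective_iff_surjective_of_finrank_eq_finrank (by omega)).1 hΨi⟩
  let e₁ := LinearEquiv.ofBijective Φ hΦb
  let e₂ := LinearEquiv.ofBijective Ψ hΨb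
  refine ⟨e₁.symm ≪≫ₗ e₂, fun σ f hf hσ => ?_, ?_⟩
  · obtain ⟨g, hg⟩ := hΦb.2 (Submodule.Quotient.mk ⟨f, hf⟩)
    have hσR : M.perm σ g ∈ R := by
      obtain ⟨_, g, rfl⟩ := g
      change M.perm σ (M.repMap b g) ∈ R
      rw [perm_repMap]
      exact Submodule.smul_mem _ _ ⟨_, rfl⟩
    have hσg : Φ ⟨M.perm σ g, hσR⟩ = Submodule.Quotient.mk ⟨M.perm σ f, hσ⟩ := by
      rw [hΦ, ← map_sub]
      exact M.perm_mem_Q ((hΦ g f hf).1 hg) σ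
    have h1 : e₁.symm (Submodule.Quotient.mk ⟨M.perm σ f, hσ⟩) = ⟨M.perm σ g, hσR⟩ := by
      rw [LinearEquiv.symm_apply_eq]; exact hσg.symm
    have h2 : e₁.symm (Submodule.Quotient.mk ⟨f, hf⟩) = g := by
      rw [LinearEquiv.symm_apply_eq]; exact hg.symm
    rw [LinearEquiv.trans_apply, LinearEquiv.trans_apply, h1, h2]
    exact M.indMap_perm hn b σ g
  · rw [← e₁.finrank_eq]
    omega

end SignedMonomials

/-- The monomial of `B n` with signed exponents `w`: positive entries are powers of `x`, negative
entries are powers of `y`. -/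
def smon (w : Fin n → ℤ) : B n :=
  ∏ j, (xv n j ^ (w j).toNat * yv n j ^ (-w j).toNat)

lemma xv_mul_yv (j : Fin n) : xv n j * yv n j = 0 := by
  rw [xv, yv, ← map_mul, Ideal.Quotient.mkₐ_eq_mk, Ideal.Quotient.eq_zero_iff_mem]
  exact Ideal.subset_span ⟨j, rfl⟩

lemma signed_pow_mul {R : Type*} [CommRing R] {x y : R} {s t : ℤ}
    (hst : 0 ≤ s * t) :
    (x ^ s.toNat * y ^ (-s).toNat) * (x ^ t.toNat * y ^ (-t).toNat) =
      x ^ (s + t).toNat * y ^ (-(s + t)).toNat := by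
  have h1 : (s + t).toNat = s.toNat + t.toNat := by
    rcases mul_nonneg_iff.1 hst with h | h <;> omega
  have h2 : (-(s + t)).toNat = (-s).toNat + (-t).toNat := by
    rcases mul_nonneg_iff.1 hst with h | h <;> omega
  rw [h1, h2, pow_add, pow_add]; ring

lemma signed_pow_mul_eq_zero {R : Type*} [CommRing R] {x y : R} (h : x * y = 0) {s t : ℤ}
    (hst : s * t < 0) :
    (x ^ s.toNat * y ^ (-s).toNat) * (x ^ t.toNat * y ^ (-t).toNat) = 0 := by
  rcases mul_neg_iff.1 hst with ⟨h1, h2⟩ | ⟨h1, h2⟩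
  · obtain ⟨a, ha⟩ : ∃ a, s.toNat = a + 1 := ⟨s.toNat - 1, by omega⟩
    obtain ⟨c, hc⟩ : ∃ a, (-t).toNat = a + 1 := ⟨(-t).toNat - 1, by omega⟩
    rw [ha, hc]
    linear_combination (x ^ a * y ^ (-s).toNat * x ^ t.toNat * y ^ c) * h
  · obtain ⟨a, ha⟩ : ∃ a, t.toNat = a + 1 := ⟨t.toNat - 1, by omega⟩
    obtain ⟨c, hc⟩ : ∃ a, (-s).toNat = a + 1 := ⟨(-s).toNat - 1, by omega⟩
    rw [ha, hc]
    linear_combination (x ^ a * y ^ (-t).toNat * x ^ s.toNat * y ^ c) * h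

lemma smon_mul {u v : Fin n → ℤ} (h : Compat u v) : smon u * smon v = smon (u + v) := by
  rw [smon, smon, smon, ← Finset.prod_mul_distrib]
  exact Finset.prod_congr rfl fun j _ => signed_pow_mul (h j)

lemma smon_mul_eq_zero {u v : Fin n → ℤ} (h : ¬ Compat u v) : smon u * smon v = 0 := by
  rw [Compat] at h
  push Not at h
  obtain ⟨j, hj⟩ := h
  rw [smon, smon, ← Finset.prod_mul_distrib]
  exact Finset.prod_eq_zero (Finset.mem_univ j) (signed_pow_mul_eq_zero (xv_mul_yv j) hj)

lemma smon_zero : smon (0 : Fin n → ℤ) = 1 := by simp [smon]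

lemma smon_yexp (K : Finset (Fin n)) : smon (yexp K) = ∏ t ∈ K, yv n t := by
  rw [smon, ← Finset.prod_filter_mul_prod_filter_not Finset.univ (· ∈ K)]
  rw [Finset.filter_mem_eq_inter, Finset.univ_inter]
  rw [Finset.prod_congr rfl (g := fun t => yv n t),
    Finset.prod_eq_one (s := Finset.filter _ _), mul_one]
  · intro j hj
    simp [yexp, (Finset.mem_filter.1 hj).2]
  · intro j hj
    simp [yexp, hj]

lemma permB_xv (σ : Equiv.Perm (Fin n)) (j : Fin n) : permB n σ (xv n j) = xv n (σ j) := by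
  change mkB n (rename (Sum.map σ σ) (X (Sum.inl j))) = _
  rw [rename_X]; rfl

lemma permB_yv (σ : Equiv.Perm (Fin n)) (j : Fin n) : permB n σ (yv n j) = yv n (σ j) := by
  change mkB n (rename (Sum.map σ σ) (X (Sum.inr j))) = _
  rw [rename_X]; rfl

lemma permB_smon (σ : Equiv.Perm (Fin n)) (w : Fin n → ℤ) :
    permB n σ (smon w) = smon (w ∘ ⇑σ⁻¹) := by
  rw [smon, map_prod, smon, ← Equiv.prod_comp σ (fun j => xv n j ^ _ * _)]
  refine Finset.prod_congr rfl fun j _ => ?_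
  simp [permB_xv, permB_yv]

lemma ev0_xv (j : Fin n) : ev0 n (xv n j) = 0 := by
  change aeval (fun _ => (0 : ℂ)) (X (Sum.inl j)) = 0
  rw [aeval_X]

lemma ev0_yv (j : Fin n) : ev0 n (yv n j) = 0 := by
  change aeval (fun _ => (0 : ℂ)) (X (Sum.inr j)) = 0
  rw [aeval_X]

lemma ev0_smon {w : Fin n → ℤ} (hw : w ≠ 0) : ev0 n (smon w) = 0 := by
  obtain ⟨j, hj⟩ := Function.ne_iff.1 hw
  rw [smon, map_prod]
  refine Finset.prod_eq_zero (Finset.mem_univ j) ?_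
  rw [map_mul, map_pow, map_pow, ev0_xv, ev0_yv]
  rcases lt_or_gt_of_ne hj with h | h
  · rw [zero_pow (n := (-w j).toNat), mul_zero]
    simp only [Pi.zero_apply] at h; omega
  · rw [zero_pow (n := (w j).toNat), zero_mul]
    simp only [Pi.zero_apply] at h; omega

/-- The signed exponent vector of a monomial, as a functional on polynomials. -/
def signedCoeff (n : ℕ) : MvPolynomial (Fin n ⊕ Fin n) ℂ →ₗ[ℂ] ((Fin n → ℤ) →₀ ℂ) :=
  (basisMonomials (Fin n ⊕ Fin n) ℂ).constr ℂ fun m =>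
    open Classical in
    if ∀ j, m (Sum.inl j) = 0 ∨ m (Sum.inr j) = 0 then
      Finsupp.single (fun j => (m (Sum.inl j) : ℤ) - m (Sum.inr j)) 1 else 0

lemma signedCoeff_monomial (m : Fin n ⊕ Fin n →₀ ℕ) :
    signedCoeff n (monomial m 1) = open Classical in
      if ∀ j, m (Sum.inl j) = 0 ∨ m (Sum.inr j) = 0 then
        Finsupp.single (fun j => (m (Sum.inl j) : ℤ) - m (Sum.inr j)) 1 else 0 := by
  have := (basisMonomials (Fin n ⊕ Fin n) ℂ).constr_basis ℂ (fun m =>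
    open Classical in
    if ∀ j, m (Sum.inl j) = 0 ∨ m (Sum.inr j) = 0 then
      Finsupp.single (fun j => (m (Sum.inl j) : ℤ) - m (Sum.inr j)) (1 : ℂ) else 0) m
  rwa [coe_basisMonomials] at this

lemma signedCoeff_eq_zero {p : MvPolynomial (Fin n ⊕ Fin n) ℂ} (hp : p ∈ Bideal n) :
    signedCoeff n p = 0 := by
  suffices h : ∀ a, signedCoeff n (a * p) = 0 by simpa using h 1
  induction hp using Submodule.span_induction with
  | mem p hp =>
    obtain ⟨j, rfl⟩ := hp
    intro a
    have key : ∀ m, signedCoeff n (monomial m 1 * (X (Sum.inl j) * X (Sum.inr j))) = 0 := by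
      intro m
      rw [show (X (Sum.inl j) : MvPolynomial (Fin n ⊕ Fin n) ℂ) = monomial _ 1 from rfl,
        show (X (Sum.inr j) : MvPolynomial (Fin n ⊕ Fin n) ℂ) = monomial _ 1 from rfl,
        monomial_mul, monomial_mul, one_mul, one_mul, signedCoeff_monomial, if_neg]
      intro h
      simpa using h j
    induction a using MvPolynomial.induction_on' with
    | monomial m c =>
      rw [show monomial m c = c • monomial m (1 : ℂ) by rw [smul_monomial, smul_eq_mul, mul_one],
        smul_mul_assoc, map_smul]
      exact (congrArg _ (key m)).trans (smul_zero c)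
    | add f g hf hg => rw [add_mul, map_add, hf, hg, add_zero]
  | zero => simp
  | add p q _ _ hp hq => intro a; rw [mul_add, map_add, hp, hq, add_zero]
  | smul r p _ hp => intro a; rw [smul_eq_mul, ← mul_assoc, hp]

/-- The exponent vector of a polynomial monomial lifting `smon w`. -/
def liftExp (w : Fin n → ℤ) : Fin n ⊕ Fin n →₀ ℕ :=
  Finsupp.equivFunOnFinite.symm (Sum.elim (fun j => (w j).toNat) fun j => (-w j).toNat)

lemma mkB_monomial (m : Fin n ⊕ Fin n →₀ ℕ) :
    mkB n (monomial m 1) = ∏ j, (xv n j ^ m (Sum.inl j) * yv n j ^ m (Sum.inr j)) := by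
  rw [monomial_eq, C_1, one_mul, Finsupp.prod_fintype _ _ (by simp), Fintype.prod_sum_type,
    map_mul, map_prod, map_prod, Finset.prod_mul_distrib]
  simp [xv, yv]

lemma mkB_liftExp (w : Fin n → ℤ) : mkB n (monomial (liftExp w) 1) = smon w := by
  rw [mkB_monomial]; rfl

lemma signedCoeff_liftExp (w : Fin n → ℤ) :
    signedCoeff n (monomial (liftExp w) 1) = Finsupp.single w 1 := by
  rw [signedCoeff_monomial, if_pos]
  · congr 1
    funext j
    simp only [liftExp, Finsupp.equivFunOnFinite_symm_apply_apply, Sum.elim_inl, Sum.elim_inr]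
    omega
  · intro j
    simp only [liftExp, Finsupp.equivFunOnFinite_symm_apply_apply, Sum.elim_inl, Sum.elim_inr]
    omega

lemma linearIndependent_smon : LinearIndependent ℂ (smon : (Fin n → ℤ) → B n) := by
  rw [linearIndependent_iff]
  intro l hl
  have h1 : mkB n (Finsupp.linearCombination ℂ (fun w => monomial (liftExp w) (1 : ℂ)) l) = 0 := by
    rw [← hl, Finsupp.linearCombination_apply, Finsupp.linearCombination_apply, Finsupp.sum,
      Finsupp.sum, map_sum]
    simp only [map_smul, mkB_liftExp]
  rw [Ideal.Quotient.mkₐ_eq_mk, Ideal.Quotient.eq_zero_iff_mem] at h1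
  have h2 := signedCoeff_eq_zero h1
  rw [Finsupp.linearCombination_apply, Finsupp.sum, map_sum] at h2
  simp only [map_smul, signedCoeff_liftExp, Finsupp.smul_single, smul_eq_mul, mul_one] at h2
  rw [← h2]
  exact (Finsupp.sum_single l).symm

lemma span_smon : ⊤ ≤ Submodule.span ℂ (Set.range (smon : (Fin n → ℤ) → B n)) := by
  rintro f -
  obtain ⟨p, rfl⟩ := Ideal.Quotient.mkₐ_surjective ℂ (Bideal n) f
  induction p using MvPolynomial.induction_on' with
  | add p q hp hq => rw [map_add]; exact add_mem hp hq
  | monomial m c =>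
    rw [← mul_one c, ← smul_eq_mul, ← smul_monomial, map_smul]
    refine Submodule.smul_mem _ _ ?_
    change mkB n _ ∈ _
    rw [mkB_monomial]
    by_cases h : ∀ j, m (Sum.inl j) = 0 ∨ m (Sum.inr j) = 0
    · refine Submodule.subset_span ⟨fun j => (m (Sum.inl j) : ℤ) - m (Sum.inr j), ?_⟩
      refine Finset.prod_congr rfl fun j _ => ?_
      have := h j
      beta_reduce
      congr 2 <;> omega
    · push Not at h
      obtain ⟨j, h1, h2⟩ := h
      rw [Finset.prod_eq_zero (Finset.mem_univ j)]
      · exact zero_mem _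
      · obtain ⟨r, hr⟩ := Nat.exists_eq_succ_of_ne_zero h1
        obtain ⟨s, hs⟩ := Nat.exists_eq_succ_of_ne_zero h2
        rw [hr, hs, pow_succ, pow_succ]
        linear_combination (xv n j ^ r * yv n j ^ s) * xv_mul_yv j

/-- The basis of `B n` formed by the monomials with signed exponents. -/
def smonBasis (n : ℕ) : Module.Basis (Fin n → ℤ) ℂ (B n) :=
  Module.Basis.mk linearIndependent_smon span_smon

@[simp] lemma smonBasis_apply (w : Fin n → ℤ) : smonBasis n w = smon w := by
  simp [smonBasis]

/-- The signed monomials of `B n`. -/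
def signedMonomialsB (n : ℕ) : SignedMonomials n (B n) where
  mon := smonBasis n
  mon_zero := by rw [smonBasis_apply, smon_zero]
  mon_mul h := by simp only [smonBasis_apply, smon_mul h]
  mon_mul_eq_zero h := by simp only [smonBasis_apply, smon_mul_eq_zero h]
  perm := permB n
  perm_mon σ w := by simp only [smonBasis_apply, permB_smon]
  ev := ev0 n
  ev_mon h := by rw [smonBasis_apply, ev0_smon h]

lemma signedMonomialsB_F (p : ℕ) : (signedMonomialsB n).F p = FB n p := by
  have h (K : Finset (Fin n)) : (signedMonomialsB n).mon (yexp K) = ∏ t ∈ K, yv n t :=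
    (smonBasis_apply _).trans (smon_yexp K)
  simp only [SignedMonomials.F, FB, h]

lemma signedMonomialsB_Q (p : ℕ) :
    (signedMonomialsB n).Q p = Jn n ⊓ FB n p ⊔ FB n (p + 1) := by
  rw [← signedMonomialsB_F, ← signedMonomialsB_F]; rfl

theorem exists_sq_equiv {i : ℕ} (hi : 1 ≤ i) (hin : i < n) :
    ∃ e : SQ n (FB n i) (Jn n ⊓ FB n i ⊔ FB n (i + 1)) ≃ₗ[ℂ] SignInd n,
      (∀ (σ : Equiv.Perm (Fin n)) (p : B n) (hp : p ∈ FB n i) (hq : permB n σ p ∈ FB n i),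
        e (sqMk n (FB n i) (Jn n ⊓ FB n i ⊔ FB n (i + 1)) (permB n σ p) hq) =
          signIndAct n σ (e (sqMk n (FB n i) (Jn n ⊓ FB n i ⊔ FB n (i + 1)) p hp))) ∧
      2 * Module.finrank ℂ (SQ n (FB n i) (Jn n ⊓ FB n i ⊔ FB n (i + 1))) = n.factorial := by
  have h := (signedMonomialsB n).exists_graded_equiv hi hin
  unfold SignedMonomials.Graded at h
  rw [signedMonomialsB_Q, signedMonomialsB_F] at h
  exact h

end

/-- For `n ≥ 2` and `1 ≤ i ≤ n−1`, the graded piece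
`Rₙ^{(i)} = F^i Bₙ / (F^i Jₙ + F^{i+1} Bₙ)` is isomorphic as a `ℂ[Sₙ]`-module to
`Ind^{Sₙ}_{S₂} L_{(1,1)}`; in particular its dimension is `n!/2`. -/
theorem graded_piece_is_induced_sign (n i : ℕ) (hn : 2 ≤ n) (hi1 : 1 ≤ i) (hi2 : i ≤ n - 1) :
    (∃ e : SQ n (FB n i) (Jn n ⊓ FB n i ⊔ FB n (i + 1)) ≃ₗ[ℂ] SignInd n,
      ∀ (σ : Equiv.Perm (Fin n)) (p : B n) (hp : p ∈ FB n i) (hq : permB n σ p ∈ FB n i),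
        e (sqMk n (FB n i) (Jn n ⊓ FB n i ⊔ FB n (i + 1)) (permB n σ p) hq) =
          signIndAct n σ (e (sqMk n (FB n i) (Jn n ⊓ FB n i ⊔ FB n (i + 1)) p hp))) ∧
    Module.finrank ℂ (SQ n (FB n i) (Jn n ⊓ FB n i ⊔ FB n (i + 1))) = n.factorial / 2 := by
  obtain ⟨e, he, h⟩ := exists_sq_equiv (n := n) hi1 (by omega)
  exact ⟨⟨e, he⟩, by omega⟩

end
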